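/- arXiv:1909.07446 — 3 statements merged into one kernel-verified Lean document; each statement's English description precedes it below -/
import Mathlib

section
/- Let $G$ be a finite simple connected undirected graph with exactly three leaves (degree-one vertices), and let $X\subseteq V(G)$. **Rungs.** For vertex sets $U,V$, a $UV$-path is either a vertex of $U\cap V$ or a path with one end-vertex in $U$ and the other in $V$. A $UV$-rung is an induced $UV$-path whose vertex set is minimal under inclusion among the vertex sets of induced $UV$-paths. **Nets.** For a loopless multigraph $H$, let $\nabla(H)$ be obtained from $H$ by adding an edge between each pair of leaves (vertices incident to exactly one edge) of $H$. An *$X$-net* of $G$ is a loopless multigraph $\mathbb H$ (parallel edges are allowed) whose vertices (*nodes*) and edges (*arcs*) are subsets of $X$ such that - (N1) $\mathbb H$ is connected and $\nabla(\mathbb H)$ is biconnected (connected and without a cut vertex); - (N2) the arcs of $\mathbb H$ are nonempty and pairwise disjoint, there is at least one arc, and their union is $X$; - (N3) $\mathbb H$ has exactly three leaf nodes, each of which consists of a single leaf of $G$; - (N4) for each arc $E$ with end-nodes $U,V$, each vertex of $E$ lies on a $UV$-rung of $G[E]$; - (N5) for each arc $E$ and node $V$, $E\cap V\neq\varnothing$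 if and only if $V$ is an end-node of $E$; - (N6) for vertices $u\in E$ and $v\in F$ with $E,F$ distinct arcs, $uv$ is an edge of $G$ if and only if $E$ and $F$ share a common end-node $V$ with $u,v\in V$. **Chunks.** A cutset of a multigraph is a set of its vertices whose deletion leaves a disconnected graph. A *split component* of $\mathbb H$ with *split pair* $\{U,V\}$ is either a single arc with end-nodes $U$ and $V$, or a subgraph of $\mathbb H$ containing a cutset $\{U,V\}$ (with $U\ne V$) of $\nabla(\mathbb H)$ that is maximal among the subgraphs of $\nabla(\mathbb H)$ that contain $U$ and $V$ and in which $U$ and $V$ are nonadjacent and do not form a cutset. A *$UV$-chunk* of $\mathbb H$ is the union, as a vertex set, of the arcs of one or more split components with common split pair $\{U,V\}$. **Merging.** For a $V_1V_2$-chunk $C$, the operation $\textsc{merge}(C)$ replaces all arcs of $\mathbb H$ intersecting $C$ by a single arc with end-nodes $V_1,V_2$ that equals $C$ as a vertex set, and deletes the nodes all of whose incident arcs are deleted (so $V_1$ and $V_2$, incident to the new arc, remain). **Statement.** If $C$ is a $V_1V_2$-chunk of an $X$-net $\mathbb H$ of $G$, then the multigraph obtained from $\mathbb H$ by applying $\textsc{merge}(C)$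 is again an $X$-net of $G$. -/
namespace ThreeInATree

/-! ### Leaves, paths and rungs of a simple graph -/

/-- A leaf of a simple graph: a vertex with exactly one neighbor. -/
def IsLeaf {V : Type*} (G : SimpleGraph V) (v : V) : Prop := ∃! w, G.Adj v w

/-- `P` is the vertex set of an induced `UW`-path of `G`. A path consisting of a single vertex
(`u = w`, the trivial walk) is the case of a vertex of `U ∩ W`. -/
def IsInducedUWPath {V : Type*} (G : SimpleGraph V) (U W P : Set V) : Prop :=
  ∃ u ∈ U, ∃ w ∈ W, ∃ p : G.Walk u w,
    p.IsPath ∧ p.IsChordless ∧ P = {x | x ∈ p.support}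

/-- `P` is the vertex set of a `UW`-rung of `G[A]`: it is inclusion-minimal among the vertex sets
of the induced `UW`-paths of `G[A]`. -/
def IsRungIn {V : Type*} (G : SimpleGraph V) (A U W P : Set V) : Prop :=
  Minimal (fun Q : Set V => Q ⊆ A ∧ IsInducedUWPath G U W Q) P

/-! ### Multigraphs -/

section Multigraph

variable {α β : Type*}

/-- Connectedness of a multigraph, through its underlying simple graph. -/
def IsConnected (H : Graph α β) : Prop := H.toSimpleGraph.Connected

/-- A cutset of a multigraph: a set of its vertices whose deletion leaves a disconnected graph. -/
def IsCutset (H : Graph α β) (S : Set α) : Prop :=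
  S ⊆ H.vertexSet ∧ ¬ (H.deleteVerts S).toSimpleGraph.Preconnected

/-- A biconnected multigraph: connected, and without a cut vertex. -/
def IsBiconnected (H : Graph α β) : Prop :=
  IsConnected H ∧ ∀ v ∈ H.vertexSet, ¬ IsCutset H {v}

/-- A leaf of a loopless multigraph: a vertex incident to exactly one edge. -/
def IsLeafNode (H : Graph α β) (x : α) : Prop := ∃! e, H.Inc e x

/-- The multigraph `H` with its edges relabelled by `Sum.inl`, so that further edges can be added. -/
def lift (H : Graph α β) : Graph α (β ⊕ Sym2 α) where
  vertexSet := H.vertexSet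
  IsLink e x y := ∃ b, e = Sum.inl b ∧ H.IsLink b x y
  isLink_symm _ _ := ⟨fun _ _ ⟨b, hb, h⟩ => ⟨b, hb, h.symm⟩⟩
  eq_or_eq_of_isLink_of_isLink := by
    rintro _ x y v w ⟨b, rfl, h⟩ ⟨c, hc, h'⟩
    obtain rfl := Sum.inl.inj hc
    exact h.left_eq_or_eq h'
  left_mem_of_isLink := by
    rintro _ x y ⟨b, -, h⟩
    exact h.left_mem

/-- `∇(H)`: the multigraph `H` together with one new edge `Sum.inr s(x, y)` for each pair of
distinct leaves `x`, `y` of `H`. -/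
def nabla (H : Graph α β) : Graph α (β ⊕ Sym2 α) where
  vertexSet := H.vertexSet
  IsLink e x y := (∃ b, e = Sum.inl b ∧ H.IsLink b x y) ∨
    (e = Sum.inr s(x, y) ∧ x ≠ y ∧ IsLeafNode H x ∧ IsLeafNode H y)
  isLink_symm _ _ := ⟨by
    rintro x y (⟨b, hb, h⟩ | ⟨he, hxy, hx, hy⟩)
    · exact Or.inl ⟨b, hb, h.symm⟩
    · exact Or.inr ⟨he.trans (by rw [Sym2.eq_swap]), hxy.symm, hy, hx⟩⟩
  eq_or_eq_of_isLink_of_isLink := by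
    rintro _ x y v w (⟨b, rfl, h⟩ | ⟨rfl, -⟩) (⟨c, hc, h'⟩ | ⟨hc, -⟩)
    · obtain rfl := Sum.inl.inj hc
      exact h.left_eq_or_eq h'
    · cases hc
    · cases hc
    · have := Sum.inr.inj hc
      rw [Sym2.eq_iff] at this
      tauto
  left_mem_of_isLink := by
    rintro _ x y (⟨b, -, h⟩ | ⟨-, -, ⟨e, he, -⟩, -⟩)
    · exact h.left_mem
    · exact he.vertex_mem

/-- `K` is a split component of `H` with split pair `{U, W}`: either the subgraph formed by a
single edge with ends `U` and `W`, or a subgraph of `H` containing the cutset `{U, W}` of `∇(H)`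
that is maximal among the subgraphs of `∇(H)` that contain `U` and `W` and in which `U` and `W`
are nonadjacent and do not form a cutset. -/
def IsSplitComponent (H : Graph α β) (U W : α) (K : Graph α β) : Prop :=
  (∃ e, H.IsLink e U W ∧ K = Graph.banana U W {e}) ∨
  (K ≤ H ∧ U ≠ W ∧ IsCutset (nabla H) {U, W} ∧
    Maximal (fun S : Graph α (β ⊕ Sym2 α) =>
      S ≤ nabla H ∧ U ∈ S.vertexSet ∧ W ∈ S.vertexSet ∧ ¬ S.Adj U W ∧ ¬ IsCutset S {U, W})
      (lift K))

end Multigraph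

/-! ### Nets, chunks and merging -/

section Net

variable {V : Type*}

/-- `H` is an `X`-net of `G`. The nodes and arcs of `H` are subsets of `V`; parallel arcs are
allowed, loops are not. -/
structure IsNet (G : SimpleGraph V) (X : Set V) (H : Graph (Set V) (Set V)) : Prop where
  loopless : H.Loopless
  node_subset : ∀ N ∈ H.vertexSet, N ⊆ X
  arc_subset : ∀ E ∈ H.edgeSet, E ⊆ X
  connected : IsConnected H
  biconnected : IsBiconnected (nabla H)
  exists_arc : H.edgeSet.Nonempty
  arc_nonempty : ∀ E ∈ H.edgeSet, E.Nonempty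
  arc_disjoint : H.edgeSet.PairwiseDisjoint id
  arc_cover : ⋃₀ H.edgeSet = X
  leaf_count : {N | IsLeafNode H N}.ncard = 3
  leaf_single : ∀ N, IsLeafNode H N → ∃ v, IsLeaf G v ∧ N = {v}
  rung : ∀ E U W, H.IsLink E U W → ∀ x ∈ E, ∃ P, x ∈ P ∧ IsRungIn G E U W P
  meets_iff : ∀ E ∈ H.edgeSet, ∀ N ∈ H.vertexSet, (E ∩ N).Nonempty ↔ H.Inc E N
  adj_iff : ∀ E ∈ H.edgeSet, ∀ F ∈ H.edgeSet, E ≠ F → ∀ u ∈ E, ∀ v ∈ F,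
    (G.Adj u v ↔ ∃ N, H.Inc E N ∧ H.Inc F N ∧ u ∈ N ∧ v ∈ N)

/-- `C` is a `UW`-chunk of `H`: the union of the arcs of one or more split components with
common split pair `{U, W}`. -/
def IsChunk (H : Graph (Set V) (Set V)) (U W C : Set V) : Prop :=
  ∃ 𝒦 : Set (Graph (Set V) (Set V)), 𝒦.Nonempty ∧ (∀ K ∈ 𝒦, IsSplitComponent H U W K) ∧
    C = ⋃ K ∈ 𝒦, ⋃₀ K.edgeSet

/-- The operation `merge(C)` for a `V1V2`-chunk `C`: all arcs meeting `C` are replaced by the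
single arc `C` with end-nodes `V1` and `V2`, and the nodes left without an incident arc are
deleted. -/
def merge (H : Graph (Set V) (Set V)) (V1 V2 C : Set V) : Graph (Set V) (Set V) where
  vertexSet := {N | (∃ E, H.Inc E N ∧ Disjoint E C) ∨ N = V1 ∨ N = V2}
  IsLink E U W := (E ≠ C ∧ Disjoint E C ∧ H.IsLink E U W) ∨ (E = C ∧ s(U, W) = s(V1, V2))
  isLink_symm _ _ := ⟨by
    rintro U W (⟨h, hd, hl⟩ | ⟨h, hs⟩)
    · exact Or.inl ⟨h, hd, hl.symm⟩
    · exact Or.inr ⟨h, Sym2.eq_swap.trans hs⟩⟩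
  eq_or_eq_of_isLink_of_isLink := by
    rintro E x y v w (⟨h, -, hl⟩ | ⟨h, hs⟩) (⟨h', -, hl'⟩ | ⟨h', hs'⟩)
    · exact hl.left_eq_or_eq hl'
    · exact absurd h' h
    · exact absurd h h'
    · have := hs.trans hs'.symm
      rw [Sym2.eq_iff] at this
      tauto
  left_mem_of_isLink := by
    rintro E x y (⟨-, hd, hl⟩ | ⟨-, hs⟩)
    · exact Or.inl ⟨E, hl.inc_left, hd⟩
    · rw [Sym2.eq_iff] at hs
      rcases hs with h | h
      · exact Or.inr (Or.inl h.1)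
      · exact Or.inr (Or.inr h.1)

end Net

end ThreeInATree

namespace ThreeInATree

/-! ### Chordless walks -/

section Chordless

variable {V : Type*} {G : SimpleGraph V} {u v w : V}

lemma IsChordless.reverse {p : G.Walk u v} (h : p.IsChordless) : p.reverse.IsChordless := by
  rw [SimpleGraph.Walk.isChordless_iff_forall_mem_edges] at h ⊢
  simpa using h

/-- In a path split as `p.append q`, the two parts meet only in the splitting vertex. -/
lemma eq_of_mem_support_append {p : G.Walk u v} {q : G.Walk v w} (h : (p.append q).IsPath) {x : V}
    (hp : x ∈ p.support) (hq : x ∈ q.support) : x = v := by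
  rw [SimpleGraph.Walk.isPath_def, SimpleGraph.Walk.support_append, List.nodup_append] at h
  by_contra hx
  rw [SimpleGraph.Walk.mem_support_iff] at hq
  exact h.2.2 x hp x (hq.resolve_left hx) rfl

lemma IsChordless.of_append_left {p : G.Walk u v} {q : G.Walk v w} (hp : (p.append q).IsPath)
    (h : (p.append q).IsChordless) : p.IsChordless := by
  rw [SimpleGraph.Walk.isChordless_iff_forall_mem_edges] at h ⊢
  intro x y hx hy hxy
  have := h (by simp [hx]) (by simp [hy]) hxy
  rw [SimpleGraph.Walk.edges_append, List.mem_append] at this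
  refine this.resolve_right fun hq => hxy.ne ?_
  rw [eq_of_mem_support_append hp hx (q.fst_mem_support_of_mem_edges hq),
    eq_of_mem_support_append hp hy (q.snd_mem_support_of_mem_edges hq)]

end Chordless

/-! ### Rungs -/

section Rung

variable {V : Type*} {G : SimpleGraph V} {A B U N W P Q : Set V}

lemma IsInducedUWPath.symm (h : IsInducedUWPath G U W P) : IsInducedUWPath G W U P := by
  obtain ⟨u, hu, w, hw, p, hp, hc, rfl⟩ := h
  exact ⟨w, hw, u, hu, p.reverse, hp.reverse, IsChordless.reverse hc, by simp⟩

lemma isInducedUWPath_comm : IsInducedUWPath G U W P ↔ IsInducedUWPath G W U P :=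
  ⟨.symm, .symm⟩

/-- A `UW`-rung of `G`, without reference to a host set. -/
def IsRung (G : SimpleGraph V) (U W P : Set V) : Prop :=
  Minimal (IsInducedUWPath G U W) P

lemma isRungIn_iff : IsRungIn G A U W P ↔ P ⊆ A ∧ IsRung G U W P := by
  constructor
  · intro h
    exact ⟨h.prop.1, h.prop.2, fun Q hQ hQP => h.2 ⟨hQP.trans h.prop.1, hQ⟩ hQP⟩
  · intro h
    exact ⟨⟨h.1, h.2.prop⟩, fun Q hQ hQP => h.2.2 hQ.2 hQP⟩

lemma IsRung.symm (h : IsRung G U W P) : IsRung G W U P := by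
  unfold IsRung at *
  rwa [funext fun Q => propext (isInducedUWPath_comm (G := G) (U := W) (W := U) (P := Q))]

lemma IsRungIn.symm (h : IsRungIn G A U W P) : IsRungIn G A W U P := by
  rw [isRungIn_iff] at *
  exact ⟨h.1, h.2.symm⟩

/-- A rung meets its target only in its last vertex. -/
lemma IsRung.eq_of_mem_right {u w : V} {p : G.Walk u w} (hu : u ∈ U)
    (hp : p.IsPath) (hc : p.IsChordless) (h : IsRung G U W {x | x ∈ p.support}) {x : V}
    (hx : x ∈ p.support) (hxW : x ∈ W) : x = w := by
  classical
  have hp' := hp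
  have hc' := hc
  rw [← p.take_spec hx] at hp' hc'
  have hsub := h.2 (y := {y | y ∈ (p.takeUntil x hx).support})
    ⟨u, hu, x, hxW, _, hp.takeUntil hx, IsChordless.of_append_left hp' hc', rfl⟩
    (fun y hy => p.support_takeUntil_subset_support hx hy)
  exact (eq_of_mem_support_append hp' (hsub p.end_mem_support)
    (SimpleGraph.Walk.end_mem_support _)).symm

/-- A rung meets its source only in its first vertex. -/
lemma IsRung.eq_of_mem_left {u w : V} {p : G.Walk u w} (hw : w ∈ W)
    (hp : p.IsPath) (hc : p.IsChordless) (h : IsRung G U W {x | x ∈ p.support}) {x : V}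
    (hx : x ∈ p.support) (hxU : x ∈ U) : x = u :=
  IsRung.eq_of_mem_right (p := p.reverse) hw hp.reverse (IsChordless.reverse hc)
    (by simpa using h.symm) (by simpa using hx) hxU

/-- A walk from `A` to `B` inside `A ∪ B` has an initial segment inside `A` which ends in `N`,
if `N` contains the ends of all edges from `A` to `B`. -/
lemma exists_append_of_crossing (hN : ∀ x ∈ A, ∀ y ∈ B, G.Adj x y → x ∈ N) {u w : V}
    (q : G.Walk u w) (hu : u ∈ A) (hw : w ∈ B) (hAB : Disjoint A B)
    (hq : ∀ x ∈ q.support, x ∈ A ∪ B) :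
    ∃ n ∈ N, ∃ (r : G.Walk u n) (s : G.Walk n w), q = r.append s ∧ ∀ x ∈ r.support, x ∈ A := by
  induction q with
  | nil => exact (hAB.ne_of_mem hu hw rfl).elim
  | @cons u v w h q ih =>
    by_cases hv : v ∈ A
    · obtain ⟨n, hn, r, s, rfl, hr⟩ := ih hv hw (fun x hx => hq x (by simp [hx]))
      refine ⟨n, hn, .cons h r, s, rfl, ?_⟩
      simpa [hu] using hr
    · have hvB : v ∈ B := (hq v (by simp)).resolve_left hv
      exact ⟨u, hN u hu v hvB h, .nil, .cons h q, rfl, by simpa using hu⟩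

/-- A rung `A` is contained in every induced path that runs from its source to a set `B`,
inside `A ∪ B`, if all edges from `A` to `B` start in the target of the rung. -/
lemma IsRung.subset_of_crossing (hA : IsRung G U N A)
    (hN : ∀ x ∈ A, ∀ y ∈ B, G.Adj x y → x ∈ N) (hAB : Disjoint A B) (hBU : Disjoint B U)
    (hAW : Disjoint A W) (hQ : IsInducedUWPath G U W Q) (hQAB : Q ⊆ A ∪ B) : A ⊆ Q := by
  obtain ⟨u, hu, w, hw, q, hq, hc, rfl⟩ := hQ
  have huA : u ∈ A := (hQAB q.start_mem_support).resolve_right fun h => hBU.ne_of_mem h hu rfl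
  have hwB : w ∈ B := (hQAB q.end_mem_support).resolve_left fun h => hAW.ne_of_mem h hw rfl
  obtain ⟨n, hn, r, s, rfl, hr⟩ := exists_append_of_crossing hN q huA hwB hAB hQAB
  have hsub := hA.2 (y := {y | y ∈ r.support})
    ⟨u, hu, n, hn, r, hq.of_append_left, IsChordless.of_append_left hq hc, rfl⟩ hr
  intro x hx
  have : x ∈ r.support := hsub hx
  simp [this]

/-- Two rungs joined at the node `N` form a rung. -/
lemma IsRung.union (hA : IsRung G U N A) (hB : IsRung G N W B)
    (hadj : ∀ x ∈ A, ∀ y ∈ B, (G.Adj x y ↔ x ∈ N ∧ y ∈ N)) (hAB : Disjoint A B)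
    (hBU : Disjoint B U) (hAW : Disjoint A W) : IsRung G U W (A ∪ B) := by
  constructor
  · obtain ⟨u, hu, n, hn, p, hp, hpc, rfl⟩ := hA.prop
    obtain ⟨m, hm, w, hw, q, hq, hqc, rfl⟩ := hB.prop
    have hnm : G.Adj n m := (hadj n p.end_mem_support m q.start_mem_support).2 ⟨hn, hm⟩
    have hsupp : (p.append (.cons hnm q)).support = p.support ++ q.support := by
      simp [SimpleGraph.Walk.support_append]
    refine ⟨u, hu, w, hw, p.append (.cons hnm q), ?_, ?_, ?_⟩
    · rw [SimpleGraph.Walk.isPath_def, hsupp, List.nodup_append]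
      exact ⟨hp.support_nodup, hq.support_nodup, fun x hx y hy => hAB.ne_of_mem hx hy⟩
    · have hcross : ∀ x ∈ p.support, ∀ y ∈ q.support, G.Adj x y → s(x, y) = s(n, m) := by
        intro x hx y hy hxy
        obtain ⟨hxN, hyN⟩ := (hadj x hx y hy).1 hxy
        rw [hA.eq_of_mem_right hu hp hpc hx hxN, hB.eq_of_mem_left hw hq hqc hy hyN]
      rw [SimpleGraph.Walk.isChordless_iff_forall_mem_edges]
      intro x y hx hy hxy
      rw [hsupp, List.mem_append] at hx hy
      rw [SimpleGraph.Walk.edges_append, SimpleGraph.Walk.edges_cons, List.mem_append,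
        List.mem_cons]
      rcases hx with hx | hx <;> rcases hy with hy | hy
      · exact Or.inl (hpc.mem_edges hx hy hxy)
      · exact Or.inr (Or.inl (hcross x hx y hy hxy))
      · exact Or.inr (Or.inl (Sym2.eq_swap.trans (hcross y hy x hx hxy.symm)))
      · exact Or.inr (Or.inr (hqc.mem_edges hx hy hxy))
    · ext x
      simp [hsupp]
  · intro Q hQ hQAB
    refine Set.union_subset ?_ ?_
    · exact hA.subset_of_crossing (fun x hx y hy h => ((hadj x hx y hy).1 h).1) hAB hBU hAW hQ hQAB
    · exact hB.symm.subset_of_crossing (fun x hx y hy h => ((hadj y hy x hx).1 h.symm).2)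
        hAB.symm hAW hBU hQ.symm (by rwa [Set.union_comm])

end Rung

/-! ### Paths through a prescribed edge -/

section Path

variable {α : Type*} {J : SimpleGraph α} {u w a b : α}

lemma exists_path_of_detour_right {p₁ : J.Walk u a} {p₂ : J.Walk a w} (hp : (p₁.append p₂).IsPath)
    (hab : J.Adj a b) {c : α} (hc : c ∈ p₂.support) (hca : c ≠ a) {r : J.Walk b c}
    (hr : r.IsPath) (har : a ∉ r.support)
    (hrp : ∀ x ∈ r.support, x ∈ (p₁.append p₂).support → x = c) :
    ∃ q : J.Walk u w, q.IsPath ∧ s(a, b) ∈ q.edges := by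
  classical
  refine ⟨p₁.append (.cons hab (r.append (p₂.dropUntil c hc))), ?_, by simp⟩
  have hp₂ : p₂.IsPath := hp.of_append_right
  have hd := hp₂.dropUntil hc
  have hsub := p₂.support_dropUntil_subset_support hc
  have hac : a ∉ (p₂.dropUntil c hc).support := by
    intro h
    rw [← p₂.take_spec hc] at hp₂
    exact hca (eq_of_mem_support_append hp₂ (by simp) h).symm
  have hcd : c ∉ (p₂.dropUntil c hc).support.tail := by
    have := hd.support_nodup
    rw [← SimpleGraph.Walk.cons_tail_support] at this
    exact (List.nodup_cons.1 this).1
  have hdt : ∀ x ∈ (p₂.dropUntil c hc).support.tail, x ∈ (p₂.dropUntil c hc).support :=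
    fun x => List.mem_of_mem_tail
  rw [SimpleGraph.Walk.isPath_def, SimpleGraph.Walk.support_append,
    SimpleGraph.Walk.support_cons, List.tail_cons, SimpleGraph.Walk.support_append,
    List.nodup_append, List.nodup_append]
  refine ⟨hp.of_append_left.support_nodup, ⟨hr.support_nodup, hd.support_nodup.tail, ?_⟩, ?_⟩
  · rintro x hx _ hy rfl
    obtain rfl := hrp x hx (by simp [hsub (hdt x hy)])
    exact hcd hy
  · rintro x hx _ hy rfl
    have hxa : x ∈ p₂.support → x = a := fun h => eq_of_mem_support_append hp hx h
    rcases List.mem_append.1 hy with hy | hy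
    · obtain rfl := hrp x hy (by simp [hx])
      exact hca (hxa hc)
    · obtain rfl := hxa (hsub (hdt x hy))
      exact hac (hdt _ hy)

lemma exists_path_of_detour {p : J.Walk u w} (hp : p.IsPath) (ha : a ∈ p.support)
    (hab : J.Adj a b) {c : α} (hc : c ∈ p.support) (hca : c ≠ a) {r : J.Walk b c}
    (hr : r.IsPath) (har : a ∉ r.support) (hrp : ∀ x ∈ r.support, x ∈ p.support → x = c) :
    ∃ q : J.Walk u w, q.IsPath ∧ s(a, b) ∈ q.edges := by
  classical
  rw [← p.take_spec ha] at hp hc hrp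
  rcases (SimpleGraph.Walk.mem_support_append_iff _ _).1 hc with hc | hc
  · obtain ⟨q, hq, hqe⟩ := exists_path_of_detour_right (p₁ := (p.dropUntil a ha).reverse)
      (p₂ := (p.takeUntil a ha).reverse) (by rw [← SimpleGraph.Walk.reverse_append]; exact hp.reverse)
      hab (by simpa using hc) hca hr har
      (by rw [← SimpleGraph.Walk.reverse_append]; simpa using hrp)
    exact ⟨q.reverse, hq.reverse, by simpa using hqe⟩
  · exact exists_path_of_detour_right hp hab hc hca hr har hrp

/-- The part, up to the first vertex in `T`, of a chain that avoids `a` and ends in `T`. -/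
lemma exists_walk_to_first {T : Set α} {z : α} (hz : z ∈ T)
    (h : Relation.ReflTransGen (fun x y => J.Adj x y ∧ x ≠ a) b z) (hza : z ≠ a) :
    ∃ c ∈ T, c ≠ a ∧ ∃ r : J.Walk b c, a ∉ r.support ∧ ∀ x ∈ r.support, x ∈ T → x = c := by
  induction h using Relation.ReflTransGen.head_induction_on with
  | refl => exact ⟨z, hz, hza, .nil, by simpa using hza.symm, by simp⟩
  | @head b d hbd _ ih =>
    by_cases hb : b ∈ T
    · exact ⟨b, hb, hbd.2, .nil, by simpa using hbd.2.symm, by simp⟩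
    · obtain ⟨c, hc, hca, r, har, hr⟩ := ih
      refine ⟨c, hc, hca, .cons hbd.1 r, by simp [har, hbd.2.symm], fun x hx hxT => ?_⟩
      rw [SimpleGraph.Walk.support_cons, List.mem_cons] at hx
      rcases hx with rfl | hx
      · exact absurd hxT hb
      · exact hr x hx hxT

/-- An edge `ab` with `a` on a path from `u` to `w` lies on such a path itself, if `b` can be joined
to `u` or `w` avoiding `a`. -/
lemma exists_path_through_edge {p : J.Walk u w} (hp : p.IsPath) (ha : a ∈ p.support)
    (hab : J.Adj a b) {z : α} (hz : z = u ∨ z = w) (hza : z ≠ a)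
    (h : Relation.ReflTransGen (fun x y => J.Adj x y ∧ x ≠ a) b z) :
    ∃ q : J.Walk u w, q.IsPath ∧ s(a, b) ∈ q.edges := by
  classical
  obtain ⟨c, hc, hca, r, har, hr⟩ := exists_walk_to_first (T := {x | x ∈ p.support})
    (by rcases hz with rfl | rfl <;> simp) h hza
  exact exists_path_of_detour hp ha hab hc hca r.bypass_isPath
    (fun h => har (r.support_bypass_subset_support h)) fun x hx => hr x (r.support_bypass_subset_support hx)

/-- If every vertex of `D` can be joined to `u` or `w` avoiding any other given vertex, then every
edge that meets `D` lies on a path from `u` to `w`. -/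
lemma exists_path_through_edge_of_avoiding {D : Set α}
    (hD : ∀ x y, J.Adj x y → x = u ∨ x = w ∨ x ∈ D)
    (hav : ∀ b ∈ D, ∀ a, b ≠ a → ∃ z, (z = u ∨ z = w) ∧ z ≠ a ∧
      Relation.ReflTransGen (fun x y => J.Adj x y ∧ x ≠ a) b z)
    (hDu : u ∉ D) (hDw : w ∉ D) (hne : D.Nonempty) (hab : J.Adj a b) :
    ∃ q : J.Walk u w, q.IsPath ∧ s(a, b) ∈ q.edges := by
  classical
  have hreach : ∀ {a b z : α}, Relation.ReflTransGen (fun x y => J.Adj x y ∧ x ≠ a) b z →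
      J.Reachable b z := fun h =>
    (SimpleGraph.reachable_iff_reflTransGen _ _).2 (Relation.ReflTransGen.mono (fun _ _ => And.left) _ _ h)
  obtain ⟨d, hd⟩ := hne
  have huw' : J.Reachable u w := by
    obtain ⟨z, hz, hzu, h⟩ := hav d hd u (by rintro rfl; exact hDu hd)
    obtain ⟨z', hz', hzw, h'⟩ := hav d hd w (by rintro rfl; exact hDw hd)
    obtain rfl := hz.resolve_left hzu
    obtain rfl := hz'.resolve_right hzw
    exact (hreach h').symm.trans (hreach h)
  obtain ⟨p₀, hp₀⟩ := huw'.exists_isPath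
  have hedge : ∀ a b, J.Adj a b → (∃ p : J.Walk u w, p.IsPath ∧ a ∈ p.support) →
      ∃ q : J.Walk u w, q.IsPath ∧ s(a, b) ∈ q.edges := by
    rintro a b hab ⟨p, hp, ha⟩
    rcases hD b a hab.symm with rfl | rfl | hb
    · exact exists_path_through_edge hp ha hab (Or.inl rfl) hab.ne' .refl
    · exact exists_path_through_edge hp ha hab (Or.inr rfl) hab.ne' .refl
    · obtain ⟨z, hz, hza, h⟩ := hav b hb a hab.ne'
      exact exists_path_through_edge hp ha hab hz hza h
  have hon : ∀ z, (z = u ∨ z = w) → ∃ p : J.Walk u w, p.IsPath ∧ z ∈ p.support := by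
    rintro z (rfl | rfl) <;> exact ⟨p₀, hp₀, by simp⟩
  refine hedge a b hab ?_
  rcases hD a b hab with ha | ha | ha
  · exact hon a (Or.inl ha)
  · exact hon a (Or.inr ha)
  · obtain ⟨z, hz, -, h⟩ := hav a ha b hab.ne
    clear hab ha
    induction h using Relation.ReflTransGen.head_induction_on with
    | refl => exact hon _ hz
    | head hxy _ ih =>
      obtain ⟨q, hq, he⟩ := hedge _ _ hxy.1.symm ih
      exact ⟨q, hq, q.snd_mem_support_of_mem_edges he⟩

end Path

/-! ### Connectedness of multigraphs through chains of nodes -/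

section Multigraph

variable {α β : Type*} {H S T K : Graph α β} {U W : α}

lemma preconnected_iff_reflTransGen : H.toSimpleGraph.Preconnected ↔
    ∀ x ∈ H.vertexSet, ∀ y ∈ H.vertexSet, Relation.ReflTransGen H.Adj x y := by
  constructor
  · intro h x hx y hy
    have := (SimpleGraph.reachable_iff_reflTransGen _ _).1 (h ⟨x, hx⟩ ⟨y, hy⟩)
    exact this.lift Subtype.val fun a b hab => hab.2
  · rintro h ⟨x, hx⟩ ⟨y, hy⟩
    have := h x hx y hy
    induction this using Relation.ReflTransGen.head_induction_on with
    | refl => exact .refl _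
    | @head a b hab _ ih =>
      refine .trans ?_ (ih hab.right_mem)
      by_cases hne : a = b
      · subst hne
        exact .refl _
      · exact SimpleGraph.Adj.reachable ⟨by simpa using hne, hab⟩

lemma isConnected_iff_reflTransGen : IsConnected H ↔ H.vertexSet.Nonempty ∧
    ∀ x ∈ H.vertexSet, ∀ y ∈ H.vertexSet, Relation.ReflTransGen H.Adj x y := by
  rw [IsConnected, SimpleGraph.connected_iff, preconnected_iff_reflTransGen, and_comm,
    Set.nonempty_coe_sort]

lemma not_isCutset_iff_reflTransGen {A : Set α} (hA : A ⊆ H.vertexSet) : ¬ IsCutset H A ↔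
    ∀ x ∈ H.vertexSet, x ∉ A → ∀ y ∈ H.vertexSet, y ∉ A →
      Relation.ReflTransGen (fun a b => H.Adj a b ∧ a ∉ A ∧ b ∉ A) x y := by
  have hadj : (H.deleteVerts A).Adj = fun a b => H.Adj a b ∧ a ∉ A ∧ b ∉ A := by
    ext a b
    simp [Graph.Adj]
  rw [IsCutset, not_and, not_not, preconnected_iff_reflTransGen, hadj]
  simp only [hA, true_imp_iff, Graph.vertexSet_deleteVerts, Set.mem_sdiff, and_imp]

/-- In a biconnected multigraph, any two vertices are joined by a chain avoiding a third one. -/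
lemma IsBiconnected.reflTransGen (h : IsBiconnected T) {a x y : α} (hx : x ∈ T.vertexSet)
    (hxa : x ≠ a) (hy : y ∈ T.vertexSet) (hya : y ≠ a) :
    Relation.ReflTransGen (fun p q => T.Adj p q ∧ p ≠ a ∧ q ≠ a) x y := by
  by_cases ha : a ∈ T.vertexSet
  · exact (not_isCutset_iff_reflTransGen (by simpa using ha)).1 (h.2 a ha) x hx hxa y hy hya
  · refine Relation.ReflTransGen.mono ?_ _ _ ((isConnected_iff_reflTransGen.1 h.1).2 x hx y hy)
    intro p q hpq
    refine ⟨hpq, ?_, ?_⟩ <;> rintro rfl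
    · exact ha hpq.left_mem
    · exact ha hpq.right_mem

/-! ### Split components -/

/-- The subgraph `S` of `T` enlarged by the vertex `y` and by the edges of `T` in `F`
whose ends are available. -/
def extend (S T : Graph α β) (h : S ≤ T) (y : α) (F : Set β) : Graph α β where
  vertexSet := insert y S.vertexSet
  IsLink e a b := S.IsLink e a b ∨
    (T.IsLink e a b ∧ e ∈ F ∧ a ∈ insert y S.vertexSet ∧ b ∈ insert y S.vertexSet)
  isLink_symm _ _ := ⟨by
    rintro a b (h | ⟨h, he, ha, hb⟩)
    · exact Or.inl h.symm
    · exact Or.inr ⟨h.symm, he, hb, ha⟩⟩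
  eq_or_eq_of_isLink_of_isLink := by
    have hT : ∀ {e a b}, (S.IsLink e a b ∨ (T.IsLink e a b ∧ e ∈ F ∧ a ∈ insert y S.vertexSet ∧
        b ∈ insert y S.vertexSet)) → T.IsLink e a b := fun h' =>
      h'.elim (fun h' => h'.mono h) And.left
    intro e a b c d h₁ h₂
    exact (hT h₁).left_eq_or_eq (hT h₂)
  left_mem_of_isLink := by
    rintro e a b (h | h)
    · exact Or.inr h.left_mem
    · exact h.2.2.1

lemma le_extend (h : S ≤ T) (y : α) (F : Set β) : S ≤ extend S T h y F :=
  ⟨fun _ => Or.inr, fun _ _ _ => Or.inl⟩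

lemma extend_le (h : S ≤ T) {y : α} (hy : y ∈ T.vertexSet) (F : Set β) : extend S T h y F ≤ T :=
  ⟨Set.insert_subset hy h.vertexSet_mono, fun _ _ _ h' => h'.elim (fun h' => h'.mono h) And.left⟩

/-- `S` is a candidate for a split component of `T` with split pair `{U, W}`. -/
def IsUnsplit (T : Graph α β) (U W : α) (S : Graph α β) : Prop :=
  S ≤ T ∧ U ∈ S.vertexSet ∧ W ∈ S.vertexSet ∧ ¬ S.Adj U W ∧ ¬ IsCutset S {U, W}

lemma pair_subset {A : Set α} (hU : U ∈ A) (hW : W ∈ A) : ({U, W} : Set α) ⊆ A :=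
  Set.insert_subset hU (Set.singleton_subset_iff.2 hW)

/-- A maximal unsplit subgraph contains all edges at its vertices outside the split pair. -/
lemma isLink_of_maximal_isUnsplit (hS : Maximal (IsUnsplit T U W) S) {e : β} {x y : α}
    (hx : x ∈ S.vertexSet) (hxUW : x ∉ ({U, W} : Set α)) (he : T.IsLink e x y) :
    S.IsLink e x y := by
  obtain ⟨hle, hU, hW, hadj, hcut⟩ := hS.prop
  have hS' : IsUnsplit T U W (extend S T hle y {e}) := by
    refine ⟨extend_le hle he.right_mem _, Or.inr hU, Or.inr hW, ?_, ?_⟩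
    · rintro ⟨f, h | ⟨h, rfl, -⟩⟩
      · exact hadj ⟨f, h⟩
      · rcases he.left_eq_or_eq h with rfl | rfl <;> simp at hxUW
    · rw [not_isCutset_iff_reflTransGen (pair_subset hU hW)] at hcut
      rw [not_isCutset_iff_reflTransGen (pair_subset (Or.inr hU) (Or.inr hW))]
      have hto : ∀ p ∈ (extend S T hle y {e}).vertexSet, p ∉ ({U, W} : Set α) →
          Relation.ReflTransGen (fun a b => (extend S T hle y {e}).Adj a b ∧
            a ∉ ({U, W} : Set α) ∧ b ∉ ({U, W} : Set α)) p x := by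
        rintro p (rfl | hp) hpUW
        · exact .single ⟨⟨e, Or.inr ⟨he.symm, rfl, Or.inl rfl, Or.inr hx⟩⟩, hpUW, hxUW⟩
        · refine Relation.ReflTransGen.mono ?_ _ _ (hcut p hp hpUW x hx hxUW)
          rintro a b ⟨⟨f, hf⟩, hab⟩
          exact ⟨⟨f, Or.inl hf⟩, hab⟩
      intro p hp hpUW q hq hqUW
      have : Std.Symm fun a b => (extend S T hle y {e}).Adj a b ∧
          a ∉ ({U, W} : Set α) ∧ b ∉ ({U, W} : Set α) :=
        ⟨fun a b ⟨h, ha, hb⟩ => ⟨h.symm, hb, ha⟩⟩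
      exact (hto p hp hpUW).trans (symm (hto q hq hqUW))
  exact (hS.2 hS' (le_extend _ _ _)).isLink_mono (Or.inr ⟨he, rfl, Or.inr hx, Or.inl rfl⟩)

/-- A maximal unsplit subgraph has vertices outside its split pair. -/
lemma exists_mem_of_maximal_isUnsplit (hS : Maximal (IsUnsplit T U W) S)
    (hT : IsCutset T {U, W}) : ∃ x ∈ S.vertexSet, x ∉ ({U, W} : Set α) := by
  by_contra! hcon
  obtain ⟨hle, hU, hW, hadj, -⟩ := hS.prop
  obtain ⟨x, hx, hxUW⟩ : ∃ x ∈ T.vertexSet, x ∉ ({U, W} : Set α) := by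
    by_contra! h
    exact (not_isCutset_iff_reflTransGen hT.1).2 (fun x hx hx' => absurd (h x hx) hx') hT
  refine hxUW (hcon x ((hS.2 (y := extend S T hle x ∅) ⟨extend_le hle hx _, Or.inr hU, Or.inr hW,
    ?_, ?_⟩ (le_extend _ _ _)).vertexSet_mono (Or.inl rfl)))
  · rintro ⟨f, h | h⟩
    · exact hadj ⟨f, h⟩
    · exact h.2.1
  · rw [not_isCutset_iff_reflTransGen (pair_subset (Or.inr hU) (Or.inr hW))]
    rintro p (rfl | hp) hpUW q (rfl | hq) hqUW
    · exact .refl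
    · exact absurd (hcon q hq) hqUW
    all_goals exact absurd (hcon p hp) hpUW

/-- The simple graph formed by the edges of `H` in `F`. -/
def edgeGraph (H : Graph α β) (F : Set β) : SimpleGraph α where
  Adj x y := x ≠ y ∧ ∃ e ∈ F, H.IsLink e x y
  symm := ⟨fun _ _ ⟨h, e, he, hl⟩ => ⟨h.symm, e, he, hl.symm⟩⟩
  loopless := ⟨fun _ h => h.1 rfl⟩

lemma edgeGraph_mono {F F' : Set β} (h : F ⊆ F') : edgeGraph H F ≤ edgeGraph H F' :=
  fun _ _ ⟨hne, e, he, hl⟩ => ⟨hne, e, h he, hl⟩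

/-- A set of edges of `H` attached to the rest of `H` only at `U` and `W`, without leaves other
than `U` and `W`, and all of whose edges lie on paths from `U` to `W`. -/
structure IsBlock (H : Graph α β) (U W : α) (F : Set β) : Prop where
  subset : F ⊆ H.edgeSet
  nonempty : F.Nonempty
  closed : ∀ e ∈ F, ∀ x, H.Inc e x → x ≠ U → x ≠ W → ∀ f, H.Inc f x → f ∈ F
  not_isLeafNode : ∀ e ∈ F, ∀ x, H.Inc e x → x ≠ U → x ≠ W → ¬ IsLeafNode H x
  exists_path : ∀ e ∈ F, ∀ a b, H.IsLink e a b →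
    ∃ q : (edgeGraph H F).Walk U W, q.IsPath ∧ s(a, b) ∈ q.edges

lemma isBlock_singleton [H.Loopless] {e : β} (he : H.IsLink e U W) : IsBlock H U W {e} where
  subset := by simpa using he.edge_mem
  nonempty := Set.singleton_nonempty e
  closed := by
    rintro _ rfl x hx hxU hxW
    rcases hx.eq_or_eq_of_isLink he with rfl | rfl <;> contradiction
  not_isLeafNode := by
    rintro _ rfl x hx hxU hxW
    rcases hx.eq_or_eq_of_isLink he with rfl | rfl <;> contradiction
  exists_path := by
    intro f hf a b hab
    rw [Set.mem_singleton_iff.1 hf] at hab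
    have hadj : (edgeGraph H {e}).Adj U W := ⟨he.ne, e, rfl, he⟩
    refine ⟨hadj.toWalk, ?_, ?_⟩
    · simpa using he.ne
    · simpa [Sym2.eq_iff] using hab.eq_and_eq_or_eq_and_eq he

lemma isBlock_biUnion {ι : Type*} {I : Set ι} (hI : I.Nonempty) {F : ι → Set β}
    (h : ∀ i ∈ I, IsBlock H U W (F i)) : IsBlock H U W (⋃ i ∈ I, F i) where
  subset := Set.iUnion₂_subset fun i hi => (h i hi).subset
  nonempty := by
    obtain ⟨i, hi⟩ := hI
    exact (h i hi).nonempty.mono (Set.subset_biUnion_of_mem hi)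
  closed := by
    intro e he x hx hxU hxW f hf
    simp only [Set.mem_iUnion] at he ⊢
    obtain ⟨i, hi, he⟩ := he
    exact ⟨i, hi, (h i hi).closed e he x hx hxU hxW f hf⟩
  not_isLeafNode := by
    intro e he
    simp only [Set.mem_iUnion] at he
    obtain ⟨i, hi, he⟩ := he
    exact (h i hi).not_isLeafNode e he
  exists_path := by
    intro e he a b hab
    simp only [Set.mem_iUnion] at he
    obtain ⟨i, hi, he⟩ := he
    obtain ⟨q, hq, hqe⟩ := (h i hi).exists_path e he a b hab
    exact ⟨q.mapLe (edgeGraph_mono (Set.subset_biUnion_of_mem hi)), by simpa using hq,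
      by simpa using hqe⟩

/-- The edges of a split component with a cutset as split pair form a block. -/
lemma isBlock_of_maximal [H.Loopless] (hbi : IsBiconnected (nabla H))
    (hleaf : ∀ x, IsLeafNode H x → ∃ y, y ≠ x ∧ IsLeafNode H y) (hK : K ≤ H) (hUW : U ≠ W)
    (hcut : IsCutset (nabla H) {U, W}) (hmax : Maximal (IsUnsplit (nabla H) U W) (lift K)) :
    IsBlock H U W K.edgeSet := by
  have hin : ∀ x ∈ K.vertexSet, x ∉ ({U, W} : Set α) → ∀ e y, (nabla H).IsLink e x y →
      ∃ b, e = Sum.inl b ∧ K.IsLink b x y :=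
    fun x hx hxUW e y he => isLink_of_maximal_isUnsplit hmax hx hxUW he
  have hclosed : ∀ x ∈ K.vertexSet, x ∉ ({U, W} : Set α) → ∀ e y, H.IsLink e x y →
      K.IsLink e x y := by
    intro x hx hxUW e y he
    obtain ⟨b, hb, hl⟩ := hin x hx hxUW _ y (Or.inl ⟨e, rfl, he⟩)
    obtain rfl := Sum.inl.inj hb
    exact hl
  obtain ⟨d, hd, hdUW⟩ := exists_mem_of_maximal_isUnsplit hmax hcut
  have hU : U ∈ K.vertexSet := hmax.prop.2.1
  have hW : W ∈ K.vertexSet := hmax.prop.2.2.1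
  have hKadj : ∀ {x y}, K.Adj x y → (edgeGraph H K.edgeSet).Adj x y := by
    rintro x y ⟨e, he⟩
    exact ⟨(he.mono hK).ne, e, he.edge_mem, he.mono hK⟩
  have hmemK : ∀ {e x}, e ∈ K.edgeSet → H.Inc e x → x ∈ K.vertexSet := by
    intro e x he hx
    exact ((hK.inc_congr he).2 hx).vertex_mem
  have hav : ∀ b ∈ K.vertexSet \ {U, W}, ∀ a, b ≠ a → ∃ z, (z = U ∨ z = W) ∧ z ≠ a ∧
      Relation.ReflTransGen (fun x y => (edgeGraph H K.edgeSet).Adj x y ∧ x ≠ a) b z := by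
    intro b hb a hba
    obtain ⟨z, hz, hza⟩ : ∃ z, (z = U ∨ z = W) ∧ z ≠ a := by
      by_cases h : U = a
      · exact ⟨W, Or.inr rfl, h ▸ hUW.symm⟩
      · exact ⟨U, Or.inl rfl, h⟩
    have hzK : z ∈ K.vertexSet := by rcases hz with rfl | rfl <;> assumption
    have hchain := hbi.reflTransGen (hK.vertexSet_mono hb.1) hba (hK.vertexSet_mono hzK) hza
    have hbK := hb.1
    clear hb hba
    induction hchain using Relation.ReflTransGen.head_induction_on with
    | refl => exact ⟨z, hz, hza, .refl⟩
    | @head b c hbc _ ih =>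
      by_cases hbUW : b ∈ ({U, W} : Set α)
      · exact ⟨b, hbUW, hbc.2.1, .refl⟩
      · obtain ⟨⟨e, he⟩, hba, hca⟩ := hbc
        obtain ⟨f, -, hf⟩ := hin b hbK hbUW e c he
        obtain ⟨z', hz', hza', hch⟩ := ih hf.right_mem
        exact ⟨z', hz', hza', hch.head ⟨hKadj ⟨f, hf⟩, hba⟩⟩
  refine ⟨hK.edgeSet_mono, ?_, ?_, ?_, ?_⟩
  · obtain ⟨z, hz, -, h⟩ := hav d ⟨hd, hdUW⟩ U fun h => hdUW (Or.inl h)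
    rcases h.cases_head with rfl | ⟨c, ⟨⟨-, e, he, -⟩, -⟩, -⟩
    · exact absurd hz hdUW
    · exact ⟨e, he⟩
  · rintro e he x hx hxU hxW f ⟨y, hf⟩
    exact (hclosed x (hmemK he hx) (by simp [hxU, hxW]) f y hf).edge_mem
  · intro e he x hx hxU hxW hlx
    obtain ⟨y, hyx, hly⟩ := hleaf x hlx
    obtain ⟨b, hb, -⟩ := hin x (hmemK he hx) (by simp [hxU, hxW]) (Sum.inr s(x, y)) y
      (Or.inr ⟨rfl, hyx.symm, hlx, hly⟩)
    cases hb
  · intro e he a b hab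
    refine exists_path_through_edge_of_avoiding (D := K.vertexSet \ {U, W}) ?_ hav (by simp)
      (by simp) ⟨d, hd, hdUW⟩ ⟨hab.ne, e, he, hab⟩
    rintro x y ⟨-, f, hf, hl⟩
    have := hmemK hf hl.inc_left
    by_cases hxU : x = U
    · exact Or.inl hxU
    by_cases hxW : x = W
    · exact Or.inr (Or.inl hxW)
    exact Or.inr (Or.inr ⟨this, by simp [hxU, hxW]⟩)

lemma IsSplitComponent.isBlock [H.Loopless] (hbi : IsBiconnected (nabla H))
    (hleaf : ∀ x, IsLeafNode H x → ∃ y, y ≠ x ∧ IsLeafNode H y)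
    (hK : IsSplitComponent H U W K) : IsBlock H U W K.edgeSet := by
  rcases hK with ⟨e, he, rfl⟩ | ⟨hKH, hUW, hcut, hmax⟩
  · simpa using isBlock_singleton he
  · exact isBlock_of_maximal hbi hleaf hKH hUW hcut hmax

lemma IsBlock.ne [H.Loopless] {F : Set β} (h : IsBlock H U W F) : U ≠ W := by
  obtain ⟨e, he⟩ := h.nonempty
  obtain ⟨a, b, hab⟩ := Graph.exists_isLink_of_mem_edgeSet (h.subset he)
  obtain ⟨q, hq, hqe⟩ := h.exists_path e he a b hab
  rintro rfl
  rw [SimpleGraph.Walk.isPath_iff_nil] at hq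
  simp [hq.eq_nil] at hqe

lemma IsBlock.exists_inc_left [H.Loopless] {F : Set β} (h : IsBlock H U W F) :
    ∃ e ∈ F, H.Inc e U := by
  have hne := h.ne
  obtain ⟨e, he⟩ := h.nonempty
  obtain ⟨a, b, hab⟩ := Graph.exists_isLink_of_mem_edgeSet (h.subset he)
  obtain ⟨q, -⟩ := h.exists_path e he a b hab
  cases q with
  | nil => exact absurd rfl hne
  | cons hadj _ =>
    obtain ⟨-, f, hf, hl⟩ := hadj
    exact ⟨f, hf, hl.inc_left⟩

lemma IsBlock.symm {F : Set β} (h : IsBlock H U W F) : IsBlock H W U F where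
  subset := h.subset
  nonempty := h.nonempty
  closed e he x hx hxU hxW := h.closed e he x hx hxW hxU
  not_isLeafNode e he x hx hxU hxW := h.not_isLeafNode e he x hx hxW hxU
  exists_path e he a b hab := by
    obtain ⟨q, hq, hqe⟩ := h.exists_path e he a b hab
    exact ⟨q.reverse, hq.reverse, by simpa using hqe⟩

lemma IsBlock.exists_inc_right [H.Loopless] {F : Set β} (h : IsBlock H U W F) :
    ∃ e ∈ F, H.Inc e W := h.symm.exists_inc_left

/-- If all edges at an end of a block belong to the block, then this end is a leaf. -/
lemma IsBlock.isLeafNode_left [H.Loopless] (hbi : IsBiconnected (nabla H)) {F : Set β}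
    (h : IsBlock H U W F) {L : α} (hL : IsLeafNode H L) (hLU : L ≠ U) (hLW : L ≠ W)
    (hall : ∀ e, H.Inc e U → e ∈ F) : IsLeafNode H U := by
  by_contra hU
  obtain ⟨e, -, he⟩ := h.exists_inc_left
  have hchain := hbi.reflTransGen (a := W) (show U ∈ (nabla H).vertexSet from he.vertex_mem) h.ne
    (show L ∈ (nabla H).vertexSet from hL.exists.choose_spec.vertex_mem) hLW
  have key : L = U ∨ ∃ f ∈ F, H.Inc f L := by
    clear hL hLU hLW
    induction hchain with
    | refl => exact Or.inl rfl
    | @tail x y _ hxy ih =>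
      have hxF : ∀ f, H.Inc f x → f ∈ F := by
        by_cases hxU : x = U
        · rwa [hxU]
        · obtain ⟨f, hf, hfx⟩ := ih.resolve_left hxU
          exact h.closed f hf x hfx hxU hxy.2.1
      have hxl : ¬ IsLeafNode H x := by
        by_cases hxU : x = U
        · rwa [hxU]
        · obtain ⟨f, hf, hfx⟩ := ih.resolve_left hxU
          exact h.not_isLeafNode f hf x hfx hxU hxy.2.1
      obtain ⟨⟨g, ⟨f, -, hf⟩ | ⟨-, -, hx, -⟩⟩, -⟩ := hxy
      · exact Or.inr ⟨f, hxF f hf.inc_left, hf.inc_right⟩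
      · exact absurd hx hxl
  obtain ⟨f, hf, hfL⟩ := key.resolve_left hLU
  exact h.not_isLeafNode f hf L hfL hLU hLW hL

end Multigraph

section Net

variable {V : Type*} {G : SimpleGraph V} {X : Set V} {H : Graph (Set V) (Set V)}
  {V1 V2 : Set V} {F : Set (Set V)}

/-! ### Rungs along a path of arcs -/

lemma IsNet.exists_rung_of_path (hnet : IsNet G X H) {u w : Set V}
    (p : (edgeGraph H F).Walk u w) (hp : p.IsPath) (huw : u ≠ w) {E a b : Set V} {x : V}
    (hE : E ∈ F) (hab : H.IsLink E a b) (hx : x ∈ E) :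
    ∃ P, IsRung G u w P ∧ (s(a, b) ∈ p.edges → x ∈ P) ∧
      ∀ y ∈ P, ∃ D ∈ F, y ∈ D ∧ D ∈ H.edgeSet ∧ ∀ N, H.Inc D N → N ∈ p.support := by
  induction p with
  | nil => exact absurd rfl huw
  | @cons u v w h p ih =>
    obtain ⟨E₀, hE₀, hl, x₀, hx₀, hEx⟩ : ∃ E₀ ∈ F, H.IsLink E₀ u v ∧
        ∃ x₀ ∈ E₀, s(a, b) = s(u, v) → x₀ = x := by
      by_cases hs : s(a, b) = s(u, v)
      · exact ⟨E, hE, (hab.isLink_iff_sym2_eq).2 hs, x, hx, fun _ => rfl⟩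
      · obtain ⟨-, e, he, hl⟩ := h
        obtain ⟨x₀, hx₀⟩ := hnet.arc_nonempty e hl.edge_mem
        exact ⟨e, he, hl, x₀, hx₀, fun h => absurd h hs⟩
    obtain ⟨P₁, hxP₁, hP₁⟩ := hnet.rung E₀ u v hl x₀ hx₀
    rw [isRungIn_iff] at hP₁
    obtain ⟨hP₁E, hP₁⟩ := hP₁
    rw [SimpleGraph.Walk.cons_isPath_iff] at hp
    by_cases hvw : v = w
    · subst hvw
      obtain rfl := (SimpleGraph.Walk.isPath_iff_nil.1 hp.1).eq_nil
      refine ⟨P₁, hP₁, ?_, fun y hy => ⟨E₀, hE₀, hP₁E hy, hl.edge_mem, ?_⟩⟩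
      · intro hs
        rw [← hEx (by simpa using hs)]
        exact hxP₁
      · intro N hN
        simpa using hN.eq_or_eq_of_isLink hl
    · obtain ⟨P₂, hP₂, hxP₂, hP₂F⟩ := ih hp.1 hvw
      have hne : ∀ {D}, (∀ N, H.Inc D N → N ∈ p.support) → E₀ ≠ D := by
        rintro D hD rfl
        exact hp.2 (hD u hl.inc_left)
      refine ⟨P₁ ∪ P₂, hP₁.union hP₂ ?_ ?_ ?_ ?_, ?_, ?_⟩
      · intro y hy z hz
        obtain ⟨D, -, hzD, hD, hDp⟩ := hP₂F z hz
        rw [hnet.adj_iff E₀ hl.edge_mem D hD (hne hDp) y (hP₁E hy) z hzD]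
        constructor
        · rintro ⟨N, hEN, hDN, hyN, hzN⟩
          rcases hEN.eq_or_eq_of_isLink hl with rfl | rfl
          · exact absurd (hDp _ hDN) hp.2
          · exact ⟨hyN, hzN⟩
        · rintro ⟨hyv, hzv⟩
          exact ⟨v, hl.inc_right, (hnet.meets_iff D hD v hl.right_mem).1 ⟨z, hzD, hzv⟩, hyv, hzv⟩
      · rw [Set.disjoint_left]
        intro y hy hz
        obtain ⟨D, -, hzD, hD, hDp⟩ := hP₂F y hz
        exact (hnet.arc_disjoint hl.edge_mem hD (hne hDp)).ne_of_mem (hP₁E hy) hzD rfl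
      · rw [Set.disjoint_left]
        intro z hz hzu
        obtain ⟨D, -, hzD, hD, hDp⟩ := hP₂F z hz
        exact hp.2 (hDp u ((hnet.meets_iff D hD u hl.left_mem).1 ⟨z, hzD, hzu⟩))
      · rw [Set.disjoint_left]
        intro y hy hyw
        have hw : w ∈ H.vertexSet := by
          cases hr : p.reverse with
          | nil => exact absurd rfl hvw
          | cons h' _ =>
            obtain ⟨-, e, -, he⟩ := h'
            exact he.left_mem
        rcases ((hnet.meets_iff E₀ hl.edge_mem w hw).1 ⟨y, hP₁E hy, hyw⟩).eq_or_eq_of_isLink hl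
          with h' | h'
        · exact huw h'.symm
        · exact hvw h'.symm
      · intro hs
        rw [SimpleGraph.Walk.edges_cons, List.mem_cons] at hs
        rcases hs with hs | hs
        · rw [← hEx hs]
          exact Or.inl hxP₁
        · exact Or.inr (hxP₂ hs)
      · rintro y (hy | hy)
        · refine ⟨E₀, hE₀, hP₁E hy, hl.edge_mem, fun N hN => ?_⟩
          rcases hN.eq_or_eq_of_isLink hl with rfl | rfl <;> simp
        · obtain ⟨D, hDF, hyD, hD, hDp⟩ := hP₂F y hy
          exact ⟨D, hDF, hyD, hD, fun N hN => by simp [hDp N hN]⟩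

/-- Every vertex of a block lies on a rung between the ends of the block. -/
lemma IsNet.exists_isRungIn_block (hnet : IsNet G X H) (hF : IsBlock H V1 V2 F) {x : V}
    (hx : x ∈ ⋃₀ F) : ∃ P, x ∈ P ∧ IsRungIn G (⋃₀ F) V1 V2 P := by
  have := hnet.loopless
  obtain ⟨E, hE, hxE⟩ := hx
  obtain ⟨a, b, hab⟩ := Graph.exists_isLink_of_mem_edgeSet (hF.subset hE)
  obtain ⟨q, hq, hqe⟩ := hF.exists_path E hE a b hab
  obtain ⟨P, hP, hxP, hPF⟩ := hnet.exists_rung_of_path q hq hF.ne hE hab hxE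
  refine ⟨P, hxP hqe, isRungIn_iff.2 ⟨fun y hy => ?_, hP⟩⟩
  obtain ⟨D, hD, hyD, -⟩ := hPF y hy
  exact ⟨D, hD, hyD⟩

/-! ### The merged multigraph -/

lemma IsNet.disjoint_sUnion_iff (hnet : IsNet G X H) (hF : F ⊆ H.edgeSet) {E : Set V}
    (hE : E ∈ H.edgeSet) : Disjoint E (⋃₀ F) ↔ E ∉ F := by
  constructor
  · intro h hEF
    obtain ⟨x, hx⟩ := hnet.arc_nonempty E hE
    exact h.ne_of_mem hx ⟨E, hEF, hx⟩ rfl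
  · intro h
    rw [Set.disjoint_sUnion_right]
    rintro D hD
    refine hnet.arc_disjoint hE (hF hD) ?_
    rintro rfl
    exact h hD

lemma IsNet.merge_isLink_iff (hnet : IsNet G X H) (hF : F ⊆ H.edgeSet) {E U W : Set V} :
    (merge H V1 V2 (⋃₀ F)).IsLink E U W ↔
      (E ∉ F ∧ H.IsLink E U W) ∨ (E = ⋃₀ F ∧ s(U, W) = s(V1, V2)) := by
  change (E ≠ ⋃₀ F ∧ Disjoint E (⋃₀ F) ∧ H.IsLink E U W) ∨ _ ↔ _
  refine or_congr_left ⟨fun h => ?_, fun h => ?_⟩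
  · exact ⟨(hnet.disjoint_sUnion_iff hF h.2.2.edge_mem).1 h.2.1, h.2.2⟩
  · have hd := (hnet.disjoint_sUnion_iff hF h.2.edge_mem).2 h.1
    refine ⟨?_, hd, h.2⟩
    obtain ⟨x, hx⟩ := hnet.arc_nonempty E h.2.edge_mem
    intro hEF
    exact hd.ne_of_mem hx (hEF ▸ hx) rfl

lemma IsNet.merge_inc_iff (hnet : IsNet G X H) (hF : F ⊆ H.edgeSet) {E N : Set V} :
    (merge H V1 V2 (⋃₀ F)).Inc E N ↔
      (E ∉ F ∧ H.Inc E N) ∨ (E = ⋃₀ F ∧ (N = V1 ∨ N = V2)) := by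
  simp only [Graph.Inc, hnet.merge_isLink_iff hF, Sym2.eq_iff]
  grind

lemma IsNet.merge_mem_edgeSet_iff (hnet : IsNet G X H) (hF : F ⊆ H.edgeSet) {E : Set V} :
    E ∈ (merge H V1 V2 (⋃₀ F)).edgeSet ↔ (E ∉ F ∧ E ∈ H.edgeSet) ∨ E = ⋃₀ F := by
  simp only [Graph.edge_mem_iff_exists_isLink, hnet.merge_isLink_iff hF]
  grind

lemma IsNet.merge_mem_vertexSet_iff (hnet : IsNet G X H) (hF : F ⊆ H.edgeSet) {N : Set V} :
    N ∈ (merge H V1 V2 (⋃₀ F)).vertexSet ↔ (∃ E, H.Inc E N ∧ E ∉ F) ∨ N = V1 ∨ N = V2 := by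
  change (∃ E, H.Inc E N ∧ Disjoint E (⋃₀ F)) ∨ _ ↔ _
  refine or_congr_left (exists_congr fun E => and_congr_right fun h => ?_)
  exact hnet.disjoint_sUnion_iff hF h.edge_mem

lemma IsNet.exists_leaf_ne (hnet : IsNet G X H) (A B : Set V) :
    ∃ L, IsLeafNode H L ∧ L ≠ A ∧ L ≠ B := by
  by_contra! h
  have hsub : {N | IsLeafNode H N} ⊆ {A, B} := by
    intro N hN
    by_cases hNA : N = A
    · exact Or.inl hNA
    · exact Or.inr (h N hN hNA)
  have hle := (Set.ncard_le_ncard hsub (by simp)).trans (Set.ncard_insert_le A {B})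
  rw [Set.ncard_singleton] at hle
  have := hnet.leaf_count
  omega

lemma IsNet.isBlock_of_isChunk (hnet : IsNet G X H) {C : Set V} (hC : IsChunk H V1 V2 C) :
    ∃ F, IsBlock H V1 V2 F ∧ C = ⋃₀ F := by
  have := hnet.loopless
  obtain ⟨𝒦, h𝒦, hK, rfl⟩ := hC
  refine ⟨⋃ K ∈ 𝒦, K.edgeSet, isBlock_biUnion h𝒦 fun K hKm => (hK K hKm).isBlock hnet.biconnected ?_,
    ?_⟩
  · intro x _
    obtain ⟨y, hy, hyx, -⟩ := hnet.exists_leaf_ne x x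
    exact ⟨y, hyx, hy⟩
  · simp only [Set.sUnion_iUnion]

/-- A node with arcs both inside and outside the block is an end of the block. -/
lemma IsBlock.eq_or_eq_of_inc (hF : IsBlock H V1 V2 F) {D E N : Set V} (hDN : H.Inc D N)
    (hD : D ∉ F) (hEN : H.Inc E N) (hE : E ∈ F) : N = V1 ∨ N = V2 := by
  by_contra! h
  exact hD (hF.closed E hE N hEN h.1 h.2 D hDN)

lemma IsNet.merge_isLeafNode_iff (hnet : IsNet G X H) (hF : IsBlock H V1 V2 F) {N : Set V} :
    IsLeafNode (merge H V1 V2 (⋃₀ F)) N ↔ IsLeafNode H N := by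
  have := hnet.loopless
  by_cases hN : N = V1 ∨ N = V2
  · obtain ⟨D, hD, hDN⟩ : ∃ D ∈ F, H.Inc D N := by
      rcases hN with rfl | rfl
      exacts [hF.exists_inc_left, hF.exists_inc_right]
    have hleaf : (∀ E, H.Inc E N → E ∈ F) → IsLeafNode H N := by
      intro hall
      obtain ⟨L, hL, hL1, hL2⟩ := hnet.exists_leaf_ne V1 V2
      rcases hN with rfl | rfl
      exacts [hF.isLeafNode_left hnet.biconnected hL hL1 hL2 hall,
        hF.symm.isLeafNode_left hnet.biconnected hL hL2 hL1 hall]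
    constructor
    · intro h
      refine hleaf fun E hE => by_contra fun hEF => ?_
      have h1 := h.unique ((hnet.merge_inc_iff hF.subset).2 (Or.inl ⟨hEF, hE⟩))
        ((hnet.merge_inc_iff hF.subset).2 (Or.inr ⟨rfl, hN⟩))
      have hd := (hnet.disjoint_sUnion_iff hF.subset hE.edge_mem).2 hEF
      obtain ⟨x, hx⟩ := hnet.arc_nonempty E hE.edge_mem
      exact hd.ne_of_mem hx (h1 ▸ hx) rfl
    · intro h
      refine ⟨⋃₀ F, (hnet.merge_inc_iff hF.subset).2 (Or.inr ⟨rfl, hN⟩), fun E hE => ?_⟩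
      rcases (hnet.merge_inc_iff hF.subset).1 hE with ⟨hEF, hE⟩ | ⟨hE, -⟩
      · exact absurd (h.unique hDN hE ▸ hD) hEF
      · exact hE
  · have hinc : ∀ E, (merge H V1 V2 (⋃₀ F)).Inc E N ↔ E ∉ F ∧ H.Inc E N := by
      intro E
      rw [hnet.merge_inc_iff hF.subset]
      simp [hN]
    have hiff : (∃ E ∉ F, H.Inc E N) → ∀ E, (merge H V1 V2 (⋃₀ F)).Inc E N ↔ H.Inc E N := by
      rintro ⟨D, hD, hDN⟩ E
      rw [hinc, and_iff_right_iff_imp]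
      intro hEN hE
      exact hN (hF.eq_or_eq_of_inc hDN hD hEN hE)
    constructor
    · intro h
      obtain ⟨D, hD⟩ := h.exists
      simpa only [IsLeafNode, hiff ⟨D, (hinc D).1 hD⟩] using h
    · intro h
      obtain ⟨D, hD⟩ := h.exists
      have hDF : D ∉ F := fun hDF =>
        hF.not_isLeafNode D hDF N hD (fun h => hN (Or.inl h)) (fun h => hN (Or.inr h)) h
      simpa only [IsLeafNode, hiff ⟨D, hDF, hD⟩] using h

/-- Contracting the interior of the block to an end `Z` of it maps `H` to the merge. -/
lemma IsNet.exists_contraction (hnet : IsNet G X H) (hF : IsBlock H V1 V2 F) {Z : Set V}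
    (hZ : Z = V1 ∨ Z = V2) :
    ∃ φ : Set V → Set V, (∀ N ∈ (merge H V1 V2 (⋃₀ F)).vertexSet, φ N = N) ∧
      (∀ N, φ N = N ∨ φ N = Z) ∧
      ∀ M N, H.Adj M N → φ M = φ N ∨ (merge H V1 V2 (⋃₀ F)).Adj (φ M) (φ N) := by
  classical
  refine ⟨fun N => if N ∈ (merge H V1 V2 (⋃₀ F)).vertexSet then N else Z,
    fun N hN => if_pos hN, fun N => ite_eq_or_eq _ _ _, ?_⟩
  rintro M N ⟨E, hE⟩
  by_cases hEF : E ∈ F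
  · have hend : ∀ N, H.Inc E N →
        (if N ∈ (merge H V1 V2 (⋃₀ F)).vertexSet then N else Z) = V1 ∨
        (if N ∈ (merge H V1 V2 (⋃₀ F)).vertexSet then N else Z) = V2 := by
      intro N hN
      split_ifs with h
      · rw [hnet.merge_mem_vertexSet_iff hF.subset] at h
        rcases h with ⟨D, hDN, hD⟩ | h
        · exact hF.eq_or_eq_of_inc hDN hD hN hEF
        · exact h
      · exact hZ
    by_cases hMN : (if M ∈ (merge H V1 V2 (⋃₀ F)).vertexSet then M else Z) =
        if N ∈ (merge H V1 V2 (⋃₀ F)).vertexSet then N else Z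
    · exact Or.inl hMN
    · refine Or.inr ⟨⋃₀ F, (hnet.merge_isLink_iff hF.subset).2 (Or.inr ⟨rfl, ?_⟩)⟩
      have h1 := hend M hE.inc_left
      have h2 := hend N hE.inc_right
      rw [Sym2.eq_iff]
      grind
  · refine Or.inr ?_
    simp only [if_pos ((hnet.merge_mem_vertexSet_iff hF.subset).2 (Or.inl ⟨E, hE.inc_left, hEF⟩)),
      if_pos ((hnet.merge_mem_vertexSet_iff hF.subset).2 (Or.inl ⟨E, hE.inc_right, hEF⟩))]
    exact ⟨E, (hnet.merge_isLink_iff hF.subset).2 (Or.inl ⟨hEF, hE⟩)⟩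

lemma reflTransGen_of_eq_or {α : Type*} {r s : α → α → Prop} {φ : α → α}
    (h : ∀ x y, r x y → φ x = φ y ∨ s (φ x) (φ y)) {x y : α} (hxy : Relation.ReflTransGen r x y) :
    Relation.ReflTransGen s (φ x) (φ y) := by
  induction hxy with
  | refl => exact .refl
  | tail _ hyz ih =>
    rcases h _ _ hyz with h | h
    · rwa [← h]
    · exact ih.tail h

lemma IsNet.merge_vertexSet_subset (hnet : IsNet G X H) (hF : IsBlock H V1 V2 F) :
    (merge H V1 V2 (⋃₀ F)).vertexSet ⊆ H.vertexSet := by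
  have := hnet.loopless
  intro N hN
  rcases (hnet.merge_mem_vertexSet_iff hF.subset).1 hN with ⟨E, hE, -⟩ | rfl | rfl
  · exact hE.vertex_mem
  · exact hF.exists_inc_left.choose_spec.2.vertex_mem
  · exact hF.exists_inc_right.choose_spec.2.vertex_mem

lemma IsNet.left_mem_merge (hnet : IsNet G X H) (hF : IsBlock H V1 V2 F) :
    V1 ∈ (merge H V1 V2 (⋃₀ F)).vertexSet :=
  (hnet.merge_mem_vertexSet_iff hF.subset).2 (Or.inr (Or.inl rfl))

lemma IsNet.merge_connected (hnet : IsNet G X H) (hF : IsBlock H V1 V2 F) :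
    IsConnected (merge H V1 V2 (⋃₀ F)) := by
  obtain ⟨φ, hφ, -, hadj⟩ := hnet.exists_contraction hF (Or.inl rfl)
  refine isConnected_iff_reflTransGen.2 ⟨⟨V1, hnet.left_mem_merge hF⟩, fun x hx y hy => ?_⟩
  rw [← hφ x hx, ← hφ y hy]
  exact reflTransGen_of_eq_or hadj ((isConnected_iff_reflTransGen.1 hnet.connected).2
    x (hnet.merge_vertexSet_subset hF hx) y (hnet.merge_vertexSet_subset hF hy))

lemma IsNet.merge_nabla_biconnected (hnet : IsNet G X H) (hF : IsBlock H V1 V2 F) :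
    IsBiconnected (nabla (merge H V1 V2 (⋃₀ F))) := by
  have := hnet.loopless
  constructor
  · obtain ⟨hne, h⟩ := isConnected_iff_reflTransGen.1 (hnet.merge_connected hF)
    refine isConnected_iff_reflTransGen.2 ⟨hne, fun x hx y hy => ?_⟩
    refine Relation.ReflTransGen.mono ?_ _ _ (h x hx y hy)
    rintro a b ⟨e, he⟩
    exact ⟨Sum.inl e, Or.inl ⟨e, rfl, he⟩⟩
  · intro A hA
    obtain ⟨Z, hZ, hZA⟩ : ∃ Z, (Z = V1 ∨ Z = V2) ∧ Z ≠ A := by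
      by_cases h : V1 = A
      · exact ⟨V2, Or.inr rfl, h ▸ hF.ne.symm⟩
      · exact ⟨V1, Or.inl rfl, h⟩
    obtain ⟨φ, hφ, hφZ, hadj⟩ := hnet.exists_contraction hF hZ
    have hφA : ∀ N, N ≠ A → φ N ≠ A := by
      intro N hN
      rcases hφZ N with h | h <;> rwa [h]
    rw [not_isCutset_iff_reflTransGen (by simpa using hA)]
    intro x hx hxA y hy hyA
    rw [← hφ x hx, ← hφ y hy]
    refine reflTransGen_of_eq_or ?_ (hnet.biconnected.reflTransGen
      (hnet.merge_vertexSet_subset hF hx) hxA (hnet.merge_vertexSet_subset hF hy) hyA)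
    rintro M N ⟨⟨e, ⟨E, -, hE⟩ | ⟨-, hMN, hM, hN⟩⟩, hMA, hNA⟩
    · rcases hadj M N ⟨E, hE⟩ with h | ⟨D, hD⟩
      · exact Or.inl h
      · exact Or.inr ⟨⟨Sum.inl D, Or.inl ⟨D, rfl, hD⟩⟩, hφA M hMA, hφA N hNA⟩
    · rw [← hnet.merge_isLeafNode_iff hF] at hM hN
      rw [hφ M hM.exists.choose_spec.vertex_mem, hφ N hN.exists.choose_spec.vertex_mem]
      exact Or.inr ⟨⟨Sum.inr s(M, N), Or.inr ⟨rfl, hMN, hM, hN⟩⟩, hMA, hNA⟩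

/-- Adjacency between an arc outside the block and the merged arc. -/
lemma IsNet.merge_adj_iff (hnet : IsNet G X H) (hF : IsBlock H V1 V2 F) {E : Set V}
    (hE : E ∈ H.edgeSet) (hEF : E ∉ F) {u v : V} (hu : u ∈ E) (hv : v ∈ ⋃₀ F) :
    G.Adj u v ↔ ∃ N, (merge H V1 V2 (⋃₀ F)).Inc E N ∧ (merge H V1 V2 (⋃₀ F)).Inc (⋃₀ F) N ∧
      u ∈ N ∧ v ∈ N := by
  obtain ⟨D, hD, hvD⟩ := hv
  have hne : E ≠ D := by
    rintro rfl
    exact hEF hD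
  rw [hnet.adj_iff E hE D (hF.subset hD) hne u hu v hvD]
  constructor
  · rintro ⟨N, hEN, hDN, huN, hvN⟩
    exact ⟨N, (hnet.merge_inc_iff hF.subset).2 (Or.inl ⟨hEF, hEN⟩), (hnet.merge_inc_iff hF.subset).2
      (Or.inr ⟨rfl, hF.eq_or_eq_of_inc hEN hEF hDN hD⟩), huN, hvN⟩
  · rintro ⟨N, hEN, -, huN, hvN⟩
    have hN := hnet.merge_vertexSet_subset hF hEN.vertex_mem
    exact ⟨N, (hnet.meets_iff E hE N hN).1 ⟨u, hu, huN⟩,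
      (hnet.meets_iff D (hF.subset hD) N hN).1 ⟨v, hvD, hvN⟩, huN, hvN⟩

lemma IsNet.merge_block (hnet : IsNet G X H) (hF : IsBlock H V1 V2 F) :
    IsNet G X (merge H V1 V2 (⋃₀ F)) where
  loopless := by
    have := hnet.loopless
    refine ⟨fun E N hEN => ?_⟩
    rcases (hnet.merge_isLink_iff hF.subset).1 hEN with ⟨-, h⟩ | ⟨-, h⟩
    · exact h.ne rfl
    · rw [Sym2.eq_iff] at h
      have := hF.ne
      grind
  node_subset N hN := hnet.node_subset N (hnet.merge_vertexSet_subset hF hN)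
  arc_subset E hE := by
    rcases (hnet.merge_mem_edgeSet_iff hF.subset).1 hE with ⟨-, h⟩ | rfl
    · exact hnet.arc_subset E h
    · exact Set.sUnion_subset fun D hD => hnet.arc_subset D (hF.subset hD)
  connected := hnet.merge_connected hF
  biconnected := hnet.merge_nabla_biconnected hF
  exists_arc := ⟨⋃₀ F, (hnet.merge_mem_edgeSet_iff hF.subset).2 (Or.inr rfl)⟩
  arc_nonempty E hE := by
    rcases (hnet.merge_mem_edgeSet_iff hF.subset).1 hE with ⟨-, h⟩ | rfl
    · exact hnet.arc_nonempty E h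
    · obtain ⟨D, hD⟩ := hF.nonempty
      exact (hnet.arc_nonempty D (hF.subset hD)).mono (Set.subset_sUnion_of_mem hD)
  arc_disjoint := by
    intro D hD E hE hDE
    rcases (hnet.merge_mem_edgeSet_iff hF.subset).1 hD with ⟨hDF, hD⟩ | rfl <;>
      rcases (hnet.merge_mem_edgeSet_iff hF.subset).1 hE with ⟨hEF, hE⟩ | rfl
    · exact hnet.arc_disjoint hD hE hDE
    · exact (hnet.disjoint_sUnion_iff hF.subset hD).2 hDF
    · exact ((hnet.disjoint_sUnion_iff hF.subset hE).2 hEF).symm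
    · exact absurd rfl hDE
  arc_cover := by
    ext x
    rw [← hnet.arc_cover]
    constructor
    · rintro ⟨E, hE, hx⟩
      rcases (hnet.merge_mem_edgeSet_iff hF.subset).1 hE with ⟨-, h⟩ | rfl
      · exact ⟨E, h, hx⟩
      · exact Set.sUnion_mono hF.subset hx
    · rintro ⟨E, hE, hx⟩
      by_cases hEF : E ∈ F
      · exact ⟨⋃₀ F, (hnet.merge_mem_edgeSet_iff hF.subset).2 (Or.inr rfl), E, hEF, hx⟩
      · exact ⟨E, (hnet.merge_mem_edgeSet_iff hF.subset).2 (Or.inl ⟨hEF, hE⟩), hx⟩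
  leaf_count := by
    simp only [hnet.merge_isLeafNode_iff hF]
    exact hnet.leaf_count
  leaf_single N hN := hnet.leaf_single N ((hnet.merge_isLeafNode_iff hF).1 hN)
  rung E U W hE x hx := by
    rcases (hnet.merge_isLink_iff hF.subset).1 hE with ⟨-, h⟩ | ⟨rfl, h⟩
    · exact hnet.rung E U W h x hx
    · obtain ⟨P, hxP, hP⟩ := hnet.exists_isRungIn_block hF hx
      rcases Sym2.eq_iff.1 h with ⟨rfl, rfl⟩ | ⟨rfl, rfl⟩
      · exact ⟨P, hxP, hP⟩
      · exact ⟨P, hxP, hP.symm⟩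
  meets_iff E hE N hN := by
    have := hnet.loopless
    have hNH := hnet.merge_vertexSet_subset hF hN
    rw [hnet.merge_inc_iff hF.subset]
    rcases (hnet.merge_mem_edgeSet_iff hF.subset).1 hE with ⟨hEF, hE⟩ | rfl
    · rw [hnet.meets_iff E hE N hNH]
      constructor
      · exact fun h => Or.inl ⟨hEF, h⟩
      · rintro (h | ⟨rfl, -⟩)
        · exact h.2
        · obtain ⟨x, hx⟩ := hnet.arc_nonempty _ hE
          exact (((hnet.disjoint_sUnion_iff hF.subset hE).2 hEF).ne_of_mem hx hx rfl).elim
    · constructor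
      · rintro ⟨x, ⟨D, hD, hxD⟩, hxN⟩
        have hDN := (hnet.meets_iff D (hF.subset hD) N hNH).1 ⟨x, hxD, hxN⟩
        refine Or.inr ⟨rfl, ?_⟩
        rcases (hnet.merge_mem_vertexSet_iff hF.subset).1 hN with ⟨E, hEN, hE⟩ | h
        · exact hF.eq_or_eq_of_inc hEN hE hDN hD
        · exact h
      · intro h
        have hD : ∃ D ∈ F, H.Inc D N := by
          rcases h with ⟨hEF, hE⟩ | ⟨-, rfl | rfl⟩
          · obtain ⟨x, hx⟩ := hnet.arc_nonempty _ hE.edge_mem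
            exact (((hnet.disjoint_sUnion_iff hF.subset hE.edge_mem).2 hEF).ne_of_mem hx hx rfl).elim
          · exact hF.exists_inc_left
          · exact hF.exists_inc_right
        obtain ⟨D, hD, hDN⟩ := hD
        exact ((hnet.meets_iff D (hF.subset hD) N hNH).2 hDN).mono
          (Set.inter_subset_inter_left _ (Set.subset_sUnion_of_mem hD))
  adj_iff D hD E hE hDE u hu v hv := by
    rcases (hnet.merge_mem_edgeSet_iff hF.subset).1 hD with ⟨hDF, hD⟩ | rfl <;>
      rcases (hnet.merge_mem_edgeSet_iff hF.subset).1 hE with ⟨hEF, hE⟩ | rfl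
    · rw [hnet.adj_iff D hD E hE hDE u hu v hv]
      refine exists_congr fun N => ?_
      constructor
      · rintro ⟨h1, h2, h⟩
        exact ⟨(hnet.merge_inc_iff hF.subset).2 (Or.inl ⟨hDF, h1⟩),
          (hnet.merge_inc_iff hF.subset).2 (Or.inl ⟨hEF, h2⟩), h⟩
      · rintro ⟨h1, -, huN, hvN⟩
        have hN := hnet.merge_vertexSet_subset hF h1.vertex_mem
        exact ⟨(hnet.meets_iff D hD N hN).1 ⟨u, hu, huN⟩,
          (hnet.meets_iff E hE N hN).1 ⟨v, hv, hvN⟩, huN, hvN⟩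
    · exact hnet.merge_adj_iff hF hD hDF hu hv
    · rw [SimpleGraph.adj_comm, hnet.merge_adj_iff hF hE hEF hv hu]
      exact exists_congr fun N => by tauto
    · exact absurd rfl hDE

end Net

end ThreeInATree

theorem merge_preserves_net {V : Type*} [Finite V] (G : SimpleGraph V)
    (hconn : G.Connected) (hleaves : {v | ThreeInATree.IsLeaf G v}.ncard = 3)
    (X : Set V) (H : Graph (Set V) (Set V)) (hnet : ThreeInATree.IsNet G X H)
    (V1 V2 C : Set V) (hC : ThreeInATree.IsChunk H V1 V2 C) :
    ThreeInATree.IsNet G X (ThreeInATree.merge H V1 V2 C) := by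
  obtain ⟨F, hF, rfl⟩ := hnet.isBlock_of_isChunk hC
  exact hnet.merge_block hF
end

section
/- Let $G$ be a finite simple undirected graph. For a vertex $v$ let $N(v)$ be the set of neighbors of $v$ in $G$ and $N[v]=N(v)\cup\{v\}$, and for a vertex set $S$ let $G[S]$ be the subgraph of $G$ induced by $S$. A theta of $G$ is an induced subgraph of $G$ that is a subdivision of the complete bipartite graph $K_{2,3}$ (a subdivision replaces edges by internally disjoint paths of length at least one). Then $G$ contains a theta if and only if there exist distinct vertices $b, b_1, b_2, b_3$ of $G$ such that $bb_1, bb_2, bb_3$ are exactly the edges of $G[\{b,b_1,b_2,b_3\}]$, and the graph $G(b,b_1,b_2,b_3)$ contains an induced subgraph that is a tree containing all of $b_1, b_2, b_3$, where $G(b,b_1,b_2,b_3)$ is obtained from $G$ by (1) deleting all vertices of $N[b]\setminus\{b_1,b_2,b_3\}$ and then (2) for each $i\in\{1,2,3\}$, adding edges so that the remaining vertices of $N(b_i)$ form a clique. -/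
namespace Detect

/-- `H` is a subdivision of `K`: `H` arises from `K` by replacing every edge `uv` of `K` by a path
`P u v` (of length at least one) between the images of its ends, the paths being internally
disjoint from one another and from the images of the vertices of `K`, and `H` having no vertices
or edges other than these.  The path of `vu` is the path of `uv` traversed backwards. -/
def IsSubdivision {U W : Type*} (H : SimpleGraph U) (K : SimpleGraph W) : Prop :=
  ∃ (f : W ↪ U) (P : ∀ u v : W, K.Adj u v → H.Walk (f u) (f v)),
    (∀ u v (h : K.Adj u v), (P u v h).IsPath) ∧
    (∀ u v (h : K.Adj u v), P v u h.symm = (P u v h).reverse) ∧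
    (∀ u v (h : K.Adj u v) (w : W), f w ∈ (P u v h).support → w = u ∨ w = v) ∧
    (∀ u v (h : K.Adj u v) u' v' (h' : K.Adj u' v') (x : U), s(u, v) ≠ s(u', v') →
      x ∈ (P u v h).support → x ∈ (P u' v' h').support → ∃ w, f w = x) ∧
    (∀ x : U, (∃ w, f w = x) ∨ ∃ u v, ∃ h : K.Adj u v, x ∈ (P u v h).support) ∧
    (∀ x y : U, H.Adj x y → ∃ u v, ∃ h : K.Adj u v, s(x, y) ∈ (P u v h).edges)

/-- `G` contains a theta: some induced subgraph of `G` is a subdivision of `K_{2,3}`. -/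
def ContainsTheta {V : Type*} (G : SimpleGraph V) : Prop :=
  ∃ S : Set V, IsSubdivision (G.induce S) (completeBipartiteGraph (Fin 2) (Fin 3))

/-- The vertices that remain after deleting `N[b] ∖ {b1, b2, b3}`. -/
def thetaAuxVerts {V : Type*} (G : SimpleGraph V) (b b1 b2 b3 : V) : Set V :=
  (insert b (G.neighborSet b) \ {b1, b2, b3})ᶜ

/-- The graph `G(b, b1, b2, b3)`: delete `N[b] ∖ {b1, b2, b3}`, then add edges so that the
remaining vertices of each `N(bᵢ)` form a clique. -/
def thetaAux {V : Type*} (G : SimpleGraph V) (b b1 b2 b3 : V) :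
    SimpleGraph (thetaAuxVerts G b b1 b2 b3) where
  Adj x y := x ≠ y ∧
    (G.Adj x y ∨ ∃ c ∈ ({b1, b2, b3} : Set V), G.Adj c x ∧ G.Adj c y)
  symm := ⟨fun _ _ h => ⟨h.1.symm, h.2.imp (fun h => h.symm)
    (fun ⟨c, hc, h1, h2⟩ => ⟨c, hc, h2, h1⟩)⟩⟩
  loopless := ⟨fun _ h => h.1 rfl⟩

end Detect

namespace SimpleGraph

variable {X : Type*} {F : SimpleGraph X}

/-- A graph is a tree if it has a rank function such that adjacent vertices have distinct ranks, no
vertex has two neighbors of smaller rank, and every vertex but `r` has one. -/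
theorem isTree_of_rank (r : X) (d : X → ℕ)
    (hne : ∀ x y, F.Adj x y → d x ≠ d y)
    (huniq : ∀ x y z, F.Adj x y → F.Adj x z → d y < d x → d z < d x → y = z)
    (hex : ∀ x, x ≠ r → ∃ y, F.Adj x y ∧ d y < d x) : F.IsTree := by
  classical
  have hreach : ∀ n x, d x = n → F.Reachable x r := by
    intro n
    induction n using Nat.strong_induction_on with
    | _ n ih =>
      intro x hx
      by_cases hxr : x = r
      · rw [hxr]
      · obtain ⟨y, hxy, hlt⟩ := hex x hxr
        exact hxy.reachable.trans (ih (d y) (hx ▸ hlt) y rfl)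
  refine ⟨(connected_iff _).2 ⟨fun x y => (hreach _ x rfl).trans (hreach _ y rfl).symm, ⟨r⟩⟩,
    fun v c hc => ?_⟩
  obtain ⟨u, hu, hmax⟩ := c.support.toFinset.exists_max_image d ⟨v, by simp⟩
  rw [List.mem_toFinset] at hu
  have hc' := hc.rotate hu
  have hle : ∀ x ∈ (c.rotate u hu).support, d x ≤ d u := fun x hx =>
    hmax x (by simpa using (c.mem_support_rotate_iff u hu).1 hx)
  have h1 := (c.rotate u hu).adj_snd hc'.not_nil
  have h2 := ((c.rotate u hu).adj_penultimate hc'.not_nil).symm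
  exact hc'.snd_ne_penultimate (huniq u _ _ h1 h2
    ((hle _ (Walk.getVert_mem_support _ _)).lt_of_ne (hne _ _ h1).symm)
    ((hle _ (Walk.getVert_mem_support _ _)).lt_of_ne (hne _ _ h2).symm))

/-- In an acyclic graph every walk between adjacent vertices uses the edge joining them. -/
theorem IsAcyclic.mem_edges_of_adj (hF : F.IsAcyclic) {x y : X} (h : F.Adj x y)
    (w : F.Walk x y) : s(x, y) ∈ w.edges :=
  isBridge_iff_forall_walk_mem_edges.1 (isAcyclic_iff_forall_adj_isBridge.1 hF h) w

/-- A walk ending in `A` yields a path that stops at its first vertex in `A`. -/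
theorem Walk.exists_isPath_to_set (A : Set X) {v u : X} (w : F.Walk v u) (hu : u ∈ A) :
    ∃ a ∈ A, ∃ q : F.Walk v a, q.IsPath ∧ ∀ x ∈ q.support, x ∈ A → x = a := by
  classical
  suffices h : ∃ a ∈ A, ∃ q : F.Walk v a, ∀ x ∈ q.support, x ∈ A → x = a by
    obtain ⟨a, ha, q, hq⟩ := h
    exact ⟨a, ha, q.bypass, q.bypass_isPath, fun x hx => hq x (q.support_bypass_subset_support hx)⟩
  induction w with
  | nil => exact ⟨_, hu, .nil, by simp⟩
  | @cons v _ _ h w ih =>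
    by_cases hv : v ∈ A
    · exact ⟨v, hv, .nil, by simp⟩
    · obtain ⟨a, ha, q, hq⟩ := ih hu
      refine ⟨a, ha, .cons h q, fun x hx hxA => ?_⟩
      rw [Walk.support_cons, List.mem_cons] at hx
      rcases hx with rfl | hx
      · exact absurd hxA hv
      · exact hq x hx hxA

/-- A vertex with at most one neighbor is not an inner vertex of a path. -/
theorem Walk.IsPath.eq_or_eq_of_subsingleton_neighborSet {x y u : X} {p : F.Walk x y}
    (hp : p.IsPath) (hu : u ∈ p.support) (hs : (F.neighborSet u).Subsingleton) :
    u = x ∨ u = y := by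
  obtain ⟨n, rfl, hn⟩ := Walk.mem_support_iff_exists_getVert.1 hu
  by_contra! h
  have h0 : n ≠ 0 := by rintro rfl; simp at h
  have h1 : n ≠ p.length := by rintro rfl; simp at h
  have ha := p.adj_getVert_succ (i := n) (by lia)
  have hb := p.adj_getVert_succ (i := n - 1) (by lia)
  rw [Nat.sub_add_cancel (by lia)] at hb
  have := hp.getVert_injOn (by rw [Set.mem_ofPred]; lia) (by rw [Set.mem_ofPred]; lia)
    (hs ha hb.symm)
  lia

/-- Two nontrivial walks with a common end that has at most one neighbor share another vertex. -/
theorem Walk.false_of_subsingleton_neighborSet {x y z : X} {p : F.Walk x y} {q : F.Walk z x}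
    (hyx : y ≠ x) (hzx : z ≠ x)
    (hpq : ∀ v ∈ q.support, v ∈ p.support → v = x)
    (hs : (F.neighborSet x).Subsingleton) : False := by
  have h1 := p.adj_snd (Walk.not_nil_of_ne hyx.symm)
  have h2 := (q.adj_penultimate (Walk.not_nil_of_ne hzx)).symm
  have h := hs h1 h2
  exact h1.ne (hpq p.snd (h ▸ Walk.getVert_mem_support _ _) (Walk.getVert_mem_support _ _)).symm

/-- Three vertices of a tree, each with at most one neighbor, are the ends of three paths of positive
length that start at a common vertex and are otherwise disjoint. -/
theorem IsTree.exists_spider (hF : F.IsTree) {c₁ c₂ c₃ : X}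
    (h₁₂ : c₁ ≠ c₂) (h₁₃ : c₁ ≠ c₃) (h₂₃ : c₂ ≠ c₃)
    (h₁ : (F.neighborSet c₁).Subsingleton) (h₂ : (F.neighborSet c₂).Subsingleton)
    (h₃ : (F.neighborSet c₃).Subsingleton) :
    ∃ (a : X) (p₁ : F.Walk a c₁) (p₂ : F.Walk a c₂) (p₃ : F.Walk a c₃),
      (a ≠ c₁ ∧ a ≠ c₂ ∧ a ≠ c₃) ∧ (p₁.IsPath ∧ p₂.IsPath ∧ p₃.IsPath) ∧
      (∀ x ∈ p₁.support, x ∈ p₂.support → x = a) ∧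
      (∀ x ∈ p₁.support, x ∈ p₃.support → x = a) ∧
      (∀ x ∈ p₂.support, x ∈ p₃.support → x = a) := by
  classical
  obtain ⟨p, hp⟩ := (hF.connected.preconnected c₁ c₂).exists_isPath
  obtain ⟨w⟩ := hF.connected.preconnected c₃ c₁
  obtain ⟨a, ha, q, hq, hqp⟩ := w.exists_isPath_to_set {x | x ∈ p.support} p.start_mem_support
  have hc₃ : c₃ ∉ p.support := fun h =>
    (hp.eq_or_eq_of_subsingleton_neighborSet h h₃).elim h₁₃.symm h₂₃.symm
  have ha₃ : a ≠ c₃ := by rintro rfl; exact hc₃ ha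
  have ha₁ : a ≠ c₁ := by
    rintro rfl
    exact Walk.false_of_subsingleton_neighborSet (p := p) h₁₂.symm h₁₃.symm hqp h₁
  have ha₂ : a ≠ c₂ := by
    rintro rfl
    exact Walk.false_of_subsingleton_neighborSet (p := p.reverse) h₁₂ h₂₃.symm
      (fun v hv hv' => hqp v hv (by simpa using hv')) h₂
  have ha' : a ∈ p.support := ha
  refine ⟨a, (p.takeUntil a ha').reverse, p.dropUntil a ha', q.reverse, ⟨ha₁, ha₂, ha₃⟩,
    ⟨(hp.takeUntil ha').reverse, hp.dropUntil ha', hq.reverse⟩, ?_, ?_, ?_⟩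
  · intro x hx hx'
    by_contra hxa
    rw [← p.take_spec ha'] at hp
    exact hp.ne_of_mem_support_of_append hxa (by simpa using hx) hx' rfl
  · intro x hx hx'
    exact hqp x (by simpa using hx') (p.support_takeUntil_subset_support ha' (by simpa using hx))
  · intro x hx hx'
    exact hqp x (by simpa using hx') (p.support_dropUntil_subset_support ha' hx)

end SimpleGraph

namespace SimpleGraph

theorem Walk.mk_mem_edges_induce_iff {V : Type*} {G : SimpleGraph V} {S : Set V} {u v : V}
    (w : G.Walk u v) (hw : ∀ x ∈ w.support, x ∈ S) (x y : S) :
    s(x, y) ∈ (w.induce S hw).edges ↔ s(x.1, y.1) ∈ w.edges := by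
  have h : w.edges = (w.induce S hw).edges.map (Sym2.map (Embedding.induce S).toHom) :=
    (congrArg Walk.edges (w.map_induce hw)).symm.trans (Walk.edges_map _ _)
  rw [h]
  exact (List.mem_map_of_injective (Sym2.map.injective (Embedding.induce (G := G) S).injective)
    (a := s(x, y))).symm

theorem Walk.IsPath.induce {V : Type*} {G : SimpleGraph V} {S : Set V} {u v : V}
    {w : G.Walk u v} (h : w.IsPath) (hw : ∀ x ∈ w.support, x ∈ S) : (w.induce S hw).IsPath := by
  rw [Walk.isPath_def, Walk.support_induce]
  exact .of_map Subtype.val (by simpa using h.support_nodup)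

end SimpleGraph

namespace Detect

open SimpleGraph

/-- A criterion for being a subdivision of a complete bipartite graph, with one path for each
pair of vertices from the two sides. -/
theorem isSubdivision_completeBipartiteGraph {U A B : Type*} {H : SimpleGraph U}
    (x : A → U) (y : B → U) (hx : x.Injective) (hy : y.Injective) (hxy : ∀ a b, x a ≠ y b)
    (P : ∀ a b, H.Walk (x a) (y b)) (hP : ∀ a b, (P a b).IsPath)
    (hPx : ∀ a b a', x a' ∈ (P a b).support → a' = a)
    (hPy : ∀ a b b', y b' ∈ (P a b).support → b' = b)
    (hdisj : ∀ a b a' b', (a ≠ a' ∨ b ≠ b') → ∀ v ∈ (P a b).support, v ∈ (P a' b').support →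
      (∃ a, x a = v) ∨ ∃ b, y b = v)
    (hcover : ∀ v, ∃ a b, v ∈ (P a b).support)
    (hedge : ∀ u v, H.Adj u v → ∃ a b, s(u, v) ∈ (P a b).edges) :
    IsSubdivision H (completeBipartiteGraph A B) := by
  refine ⟨⟨Sum.elim x y, hx.sumElim hy hxy⟩, fun u v h =>
    match u, v, h with
    | .inl a, .inr b, _ => P a b
    | .inr b, .inl a, _ => (P a b).reverse
    | .inl _, .inl _, h => absurd h (by simp)
    | .inr _, .inr _, h => absurd h (by simp), ?_, ?_, ?_, ?_, ?_, ?_⟩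
  · rintro (a | b) (a' | b') h
    · simp at h
    · exact hP _ _
    · exact (hP _ _).reverse
    · simp at h
  · rintro (a | b) (a' | b') h
    · simp at h
    · rfl
    · exact (Walk.reverse_reverse _).symm
    · simp at h
  · rintro (a | b) (a' | b') h w hw
    · simp at h
    · rcases w with w | w
      · exact .inl (congrArg _ (hPx _ _ _ hw))
      · exact .inr (congrArg _ (hPy _ _ _ hw))
    · replace hw := List.mem_reverse.1 (Walk.support_reverse _ ▸ hw)
      rcases w with w | w
      · exact .inr (congrArg _ (hPx _ _ _ hw))
      · exact .inl (congrArg _ (hPy _ _ _ hw))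
    · simp at h
  · have key : ∀ a b a' b' v, (a ≠ a' ∨ b ≠ b') → v ∈ (P a b).support → v ∈ (P a' b').support →
        ∃ w, Sum.elim x y w = v := fun a b a' b' v hne h h' =>
      (hdisj a b a' b' hne v h h').elim (fun ⟨a, ha⟩ => ⟨.inl a, ha⟩) fun ⟨b, hb⟩ => ⟨.inr b, hb⟩
    rintro (a | b) (a' | b') h (c | d) (c' | d') h' v hne hv hv'
    all_goals first | (simp at h; done) | (simp at h'; done) | skip
    · exact key _ _ _ _ v (by grind) hv hv'
    · exact key _ _ _ _ v (by grind) hv (List.mem_reverse.1 (Walk.support_reverse _ ▸ hv'))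
    · exact key _ _ _ _ v (by grind) (List.mem_reverse.1 (Walk.support_reverse _ ▸ hv)) hv'
    · exact key _ _ _ _ v (by grind) (List.mem_reverse.1 (Walk.support_reverse _ ▸ hv))
        (List.mem_reverse.1 (Walk.support_reverse _ ▸ hv'))
  · intro v
    obtain ⟨a, b, h⟩ := hcover v
    exact .inr ⟨.inl a, .inr b, by simp, h⟩
  · intro u v huv
    obtain ⟨a, b, h⟩ := hedge u v huv
    exact ⟨.inl a, .inr b, by simp, h⟩

/-- An induced spider with three legs together with a vertex adjacent to exactly the ends of the
legs is a theta. -/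
theorem containsTheta_of_spider {V : Type*} {G : SimpleGraph V} {a b : V} {c : Fin 3 → V}
    (R : ∀ i, G.Walk a (c i)) (hR : ∀ i, (R i).IsPath) (hac : ∀ i, a ≠ c i)
    (hb : ∀ i, b ∉ (R i).support)
    (hdisj : ∀ i j, i ≠ j → ∀ x ∈ (R i).support, x ∈ (R j).support → x = a)
    (hadj : ∀ i, ∀ x ∈ (R i).support, G.Adj b x → x = c i) (hbc : ∀ i, G.Adj b (c i))
    (hedge : ∀ i j, ∀ x ∈ (R i).support, ∀ y ∈ (R j).support, G.Adj x y →
      ∃ k, s(x, y) ∈ (R k).edges) :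
    ContainsTheta G := by
  have hcR : ∀ i j, c j ∈ (R i).support → j = i := by
    intro i j h
    by_contra hij
    exact hac j (hdisj j i hij _ (R j).end_mem_support h).symm
  let S : Set V := {v | v = b ∨ ∃ i, v ∈ (R i).support}
  have hS : ∀ i, ∀ x ∈ (R i).support, x ∈ S := fun i x hx => .inr ⟨i, hx⟩
  let x : Fin 2 → S := ![⟨a, hS 0 a (R 0).start_mem_support⟩, ⟨b, .inl rfl⟩]
  let y : Fin 3 → S := fun i => ⟨c i, hS i _ (R i).end_mem_support⟩
  have hab : a ≠ b := by rintro rfl; exact hb 0 (R 0).start_mem_support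
  have hbc' : ∀ i, b ≠ c i := fun i => (hbc i).ne
  let P : ∀ k i, (G.induce S).Walk (x k) (y i) := fun k i =>
    match k with
    | 0 => (R i).induce S (hS i)
    | 1 => .cons (show (G.induce S).Adj ⟨b, .inl rfl⟩ (y i) from hbc i) .nil
  have hP0 : ∀ i (v : S), v ∈ (P 0 i).support ↔ v.1 ∈ (R i).support := by
    intro i v
    change v ∈ ((R i).induce S (hS i)).support ↔ _
    simp
  have hP1 : ∀ i (v : S), v ∈ (P 1 i).support ↔ v.1 = b ∨ v.1 = c i := by
    intro i v
    change v ∈ [_, _] ↔ _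
    simp [Subtype.ext_iff, x, y]
  have hx0 : (x 0).1 = a := rfl
  have hx1 : (x 1).1 = b := rfl
  refine ⟨S, isSubdivision_completeBipartiteGraph x y ?_ ?_ ?_ P ?_ ?_ ?_ ?_ ?_ ?_⟩
  · intro k l h
    have := congrArg Subtype.val h
    fin_cases k <;> fin_cases l <;> simp_all [x]
  · intro i j h
    exact hcR j i (by rw [show c i = c j from congrArg Subtype.val h]; exact (R j).end_mem_support)
  · intro k i h
    have := congrArg Subtype.val h
    fin_cases k
    · exact hac i this
    · exact hbc' i this
  · intro k i
    match k with
    | 0 => exact (hR i).induce (hS i)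
    | 1 =>
      refine (Walk.cons_isPath_iff _ _).2 ⟨.nil, ?_⟩
      simpa [Subtype.ext_iff, x, y] using hbc' i
  · intro k i k' h
    match k, k' with
    | 0, 0 => rfl
    | 0, 1 => exact absurd ((hP0 i _).1 h) (hb i)
    | 1, 0 => exact absurd ((hP1 i _).1 h) (by simp [hx0, hab, hac i])
    | 1, 1 => rfl
  · intro k i j h
    match k with
    | 0 => exact hcR i j ((hP0 i _).1 h)
    | 1 =>
      rcases (hP1 i _).1 h with h | h
      · exact absurd h (hbc' j).symm
      · exact hcR i j (by rw [show c j = c i from h]; exact (R i).end_mem_support)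
  · intro k i k' j hne v hv hv'
    match k, k' with
    | 0, 0 =>
      exact .inl ⟨0, Subtype.ext (hdisj i j (by simpa using hne) v ((hP0 i _).1 hv)
        ((hP0 j _).1 hv')).symm⟩
    | 1, _ =>
      rcases (hP1 i _).1 hv with h | h
      · exact .inl ⟨1, Subtype.ext h.symm⟩
      · exact .inr ⟨i, Subtype.ext h.symm⟩
    | 0, 1 =>
      rcases (hP1 j _).1 hv' with h | h
      · exact .inl ⟨1, Subtype.ext h.symm⟩
      · exact .inr ⟨j, Subtype.ext h.symm⟩
  · rintro ⟨v, rfl | ⟨i, hi⟩⟩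
    · exact ⟨1, 0, (hP1 0 _).2 (.inl rfl)⟩
    · exact ⟨0, i, (hP0 i _).2 hi⟩
  · have hbe : ∀ v : S, G.Adj b v.1 → ∃ i, v = y i := by
      rintro ⟨v, rfl | ⟨i, hi⟩⟩ h
      · exact absurd h (G.irrefl)
      · exact ⟨i, Subtype.ext (hadj i v hi h)⟩
    have hPe : ∀ i, s(x 1, y i) ∈ (P 1 i).edges := fun i => List.mem_singleton.2 rfl
    rintro ⟨u, hu⟩ ⟨v, hv⟩ huv
    have huv' : G.Adj u v := huv
    rcases hu with rfl | ⟨i, hi⟩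
    · obtain ⟨i, hi⟩ := hbe ⟨v, hv⟩ huv'
      exact ⟨1, i, by rw [hi]; exact hPe i⟩
    · rcases hv with rfl | ⟨j, hj⟩
      · obtain ⟨i, hi⟩ := hbe ⟨u, hS i u hi⟩ huv'.symm
        exact ⟨1, i, by rw [hi, Sym2.eq_swap]; exact hPe i⟩
      · obtain ⟨k, hk⟩ := hedge i j u hi v hj huv'
        exact ⟨0, k, ((R k).mk_mem_edges_induce_iff (hS k) _ _).2 hk⟩

/-- An induced tree of `G(b, b₁, b₂, b₃)` through `b₁`, `b₂`, `b₃` yields a theta of `G`. -/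
theorem containsTheta_of_isTree {V : Type*} {G : SimpleGraph V} {b b1 b2 b3 : V}
    (h12 : b1 ≠ b2) (h23 : b2 ≠ b3) (h13 : b1 ≠ b3)
    (hb1 : G.Adj b b1) (hb2 : G.Adj b b2) (hb3 : G.Adj b b3)
    (T : Set (thetaAuxVerts G b b1 b2 b3)) (hT1 : b1 ∈ Subtype.val '' T)
    (hT2 : b2 ∈ Subtype.val '' T) (hT3 : b3 ∈ Subtype.val '' T)
    (hT : ((thetaAux G b b1 b2 b3).induce T).IsTree) : ContainsTheta G := by
  classical
  set F := (thetaAux G b b1 b2 b3).induce T with hF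
  have hFadj : ∀ x y : T, F.Adj x y ↔ x.1.1 ≠ y.1.1 ∧ (G.Adj x.1.1 y.1.1 ∨
      ∃ c ∈ ({b1, b2, b3} : Set V), G.Adj c x.1.1 ∧ G.Adj c y.1.1) := fun x y => by
    simp [hF, thetaAux, Subtype.ext_iff]
  have hlift : ∀ c ∈ ({b1, b2, b3} : Set V), ∃ c' : T, c'.1.1 = c := by
    rintro c (rfl | rfl | rfl)
    · obtain ⟨c', h, h'⟩ := hT1; exact ⟨⟨c', h⟩, h'⟩
    · obtain ⟨c', h, h'⟩ := hT2; exact ⟨⟨c', h⟩, h'⟩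
    · obtain ⟨c', h, h'⟩ := hT3; exact ⟨⟨c', h⟩, h'⟩
  have htri : ∀ c ∈ ({b1, b2, b3} : Set V), ∀ x y : T, G.Adj c x.1.1 → G.Adj c y.1.1 → x = y := by
    intro c hc x y hx hy
    by_contra hxy
    obtain ⟨c', rfl⟩ := hlift c hc
    have hcx : F.Adj c' x := (hFadj _ _).2 ⟨hx.ne, .inl hx⟩
    have hcy : F.Adj c' y := (hFadj _ _).2 ⟨hy.ne, .inl hy⟩
    have hxy' : F.Adj x y := (hFadj _ _).2
      ⟨fun h => hxy (Subtype.ext (Subtype.ext h)), .inr ⟨_, hc, hx, hy⟩⟩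
    have := hT.isAcyclic.mem_edges_of_adj hxy' (.cons hcx.symm (.cons hcy .nil))
    simp at this
    grind [hcx.ne, hcy.ne]
  have hGadj : ∀ x y : T, F.Adj x y ↔ G.Adj x.1.1 y.1.1 := by
    intro x y
    rw [hFadj]
    refine ⟨fun ⟨hne, h⟩ => h.resolve_right ?_, fun h => ⟨h.ne, .inl h⟩⟩
    rintro ⟨c, hc, hx, hy⟩
    exact hne (by rw [htri c hc x y hx hy])
  have hsub : ∀ c : T, c.1.1 ∈ ({b1, b2, b3} : Set V) → (F.neighborSet c).Subsingleton :=
    fun c hc x hx y hy => htri _ hc x y ((hGadj _ _).1 hx) ((hGadj _ _).1 hy)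
  have hbT : ∀ x : T, x.1.1 ≠ b ∧ (G.Adj b x.1.1 → x.1.1 ∈ ({b1, b2, b3} : Set V)) := by
    intro x
    have := x.1.2
    simp only [thetaAuxVerts, Set.mem_compl_iff, Set.mem_sdiff, Set.mem_insert_iff,
      mem_neighborSet] at this
    constructor
    · intro h
      simp [h, hb1.ne, hb2.ne, hb3.ne] at this
    · intro h
      by_contra h'
      exact this ⟨.inr h, h'⟩
  obtain ⟨c1, hc1⟩ := hlift b1 (by simp)
  obtain ⟨c2, hc2⟩ := hlift b2 (by simp)
  obtain ⟨c3, hc3⟩ := hlift b3 (by simp)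
  have hne : ∀ {u v : V} {x y : T}, x.1.1 = u → y.1.1 = v → u ≠ v → x ≠ y :=
    fun hx hy h h' => h (by rw [← hx, ← hy, h'])
  obtain ⟨a, p1, p2, p3, ⟨ha1, ha2, ha3⟩, ⟨hp1, hp2, hp3⟩, hd12, hd13, hd23⟩ :=
    hT.exists_spider (hne hc1 hc2 h12) (hne hc1 hc3 h13) (hne hc2 hc3 h23)
      (hsub _ (by simp [hc1])) (hsub _ (by simp [hc2])) (hsub _ (by simp [hc3]))
  let φ : F →g G := ⟨fun x => x.1.1, fun {x y} h => (hGadj x y).1 h⟩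
  have hφ : Function.Injective φ := fun x y h => Subtype.ext (Subtype.ext h)
  let c : Fin 3 → T := ![c1, c2, c3]
  let p : ∀ i, F.Walk a (c i) := fun i => match i with
    | 0 => p1
    | 1 => p2
    | 2 => p3
  have hpath : ∀ i, (p i).IsPath := fun i => match i with
    | 0 => hp1
    | 1 => hp2
    | 2 => hp3
  have hac : ∀ i, a ≠ c i := fun i => match i with
    | 0 => ha1
    | 1 => ha2
    | 2 => ha3
  have hpd : ∀ i j, i ≠ j → ∀ x ∈ (p i).support, x ∈ (p j).support → x = a := by
    intro i j hij x hx hx'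
    match i, j with
    | 0, 0 => exact absurd rfl hij
    | 0, 1 => exact hd12 x hx hx'
    | 0, 2 => exact hd13 x hx hx'
    | 1, 0 => exact hd12 x hx' hx
    | 1, 1 => exact absurd rfl hij
    | 1, 2 => exact hd23 x hx hx'
    | 2, 0 => exact hd13 x hx' hx
    | 2, 1 => exact hd23 x hx' hx
    | 2, 2 => exact absurd rfl hij
  have hmem : ∀ i v, v ∈ ((p i).map φ).support → ∃ x ∈ (p i).support, φ x = v := by
    intro i v hv
    simpa only [Walk.support_map, List.mem_map] using hv
  have hbc : ∀ i, G.Adj b (c i).1.1 := fun i => match i with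
    | 0 => by simpa [c, hc1] using hb1
    | 1 => by simpa [c, hc2] using hb2
    | 2 => by simpa [c, hc3] using hb3
  refine containsTheta_of_spider (b := b) (fun i => (p i).map φ) ?_ ?_ ?_ ?_ ?_ ?_ ?_
  · exact fun i => (hpath i).map hφ
  · exact fun i h => hac i (hφ h)
  · intro i h
    obtain ⟨x, -, hx⟩ := hmem i b h
    exact (hbT x).1 hx
  · intro i j hij v hv hv'
    obtain ⟨x, hx, rfl⟩ := hmem i v hv
    obtain ⟨y, hy, hyx⟩ := hmem j _ hv'
    rw [hφ hyx] at hy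
    rw [hpd i j hij x hx hy]
  · intro i v hv hbv
    obtain ⟨x, hx, rfl⟩ := hmem i v hv
    have hxc : ∃ j, x = c j := by
      rcases (hbT x).2 hbv with h | h | h
      · exact ⟨0, hφ (h.trans hc1.symm)⟩
      · exact ⟨1, hφ (h.trans hc2.symm)⟩
      · exact ⟨2, hφ (h.trans hc3.symm)⟩
    obtain ⟨j, rfl⟩ := hxc
    by_cases hij : i = j
    · rw [hij]
    · exact absurd (hpd i j hij _ hx (p j).end_mem_support).symm (hac j)
  · exact hbc
  · intro i j u hu v hv huv
    obtain ⟨x, hx, rfl⟩ := hmem i u hu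
    obtain ⟨y, hy, rfl⟩ := hmem j v hv
    have hxy : F.Adj x y := (hGadj _ _).2 huv
    have := hT.isAcyclic.mem_edges_of_adj hxy
      (((p i).takeUntil x hx).reverse.append ((p j).takeUntil y hy))
    rw [Walk.edges_append, List.mem_append, Walk.edges_reverse, List.mem_reverse] at this
    have key : ∀ k, s(x, y) ∈ (p k).edges → s(φ x, φ y) ∈ ((p k).map φ).edges := fun k h => by
      rw [Walk.edges_map]
      exact List.mem_map_of_mem (f := Sym2.map φ) h
    rcases this with h | h
    · exact ⟨i, key i ((p i).edges_takeUntil_subset_edges hx h)⟩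
    · exact ⟨j, key j ((p j).edges_takeUntil_subset_edges hy h)⟩

end Detect

namespace SimpleGraph

theorem Walk.IsPath.append_of_forall_eq {V : Type*} {G : SimpleGraph V} {u v w : V}
    {p : G.Walk u v} {q : G.Walk v w} (hp : p.IsPath) (hq : q.IsPath)
    (h : ∀ x ∈ p.support, x ∈ q.support → x = v) : (p.append q).IsPath := by
  rw [Walk.isPath_def, Walk.support_append]
  refine hp.support_nodup.append (hq.support_nodup.sublist (List.tail_sublist _)) ?_
  intro x hx hx'
  have hxv := h x hx (List.mem_of_mem_tail hx')
  have := hq.support_nodup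
  rw [← Walk.cons_tail_support, List.nodup_cons] at this
  exact this.1 (hxv ▸ hx')

end SimpleGraph

namespace Detect

open SimpleGraph

/-- A theta consists of three paths of length at least two between two vertices that are otherwise
disjoint and contain all edges of the graph between their vertices. -/
theorem ContainsTheta.exists_paths {V : Type*} {G : SimpleGraph V} (h : ContainsTheta G) :
    ∃ (a b : V) (Q : Fin 3 → G.Walk a b), (∀ i, (Q i).IsPath) ∧ (∀ i, 2 ≤ (Q i).length) ∧
      (∀ i j, i ≠ j → ∀ x ∈ (Q i).support, x ∈ (Q j).support → x = a ∨ x = b) ∧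
      (∀ i j, ∀ x ∈ (Q i).support, ∀ y ∈ (Q j).support, G.Adj x y →
        ∃ k, s(x, y) ∈ (Q k).edges) := by
  obtain ⟨S, f, P, hpath, hrev, hbranch, hdisj, -, hedge⟩ := h
  let A : ∀ k i, (G.induce S).Walk (f (.inl k)) (f (.inr i)) := fun k i =>
    P (.inl k) (.inr i) (by simp)
  have hA : ∀ k i, (A k i).IsPath := fun k i => hpath _ _ _
  have hAA : ∀ k i l j, (k ≠ l ∨ i ≠ j) → ∀ x ∈ (A k i).support, x ∈ (A l j).support →
      (k = l ∧ x = f (.inl k)) ∨ (i = j ∧ x = f (.inr i)) := by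
    intro k i l j hne x hx hx'
    obtain ⟨w, rfl⟩ := hdisj _ _ _ _ _ _ x (by simp; tauto) hx hx'
    have h1 := hbranch _ _ _ w hx
    have h2 := hbranch _ _ _ w hx'
    rcases h1 with rfl | rfl <;> simpa using h2
  have hAlen : ∀ k i, 1 ≤ (A k i).length := fun k i =>
    Nat.one_le_iff_ne_zero.2 fun h => f.injective.ne (by simp) (Walk.eq_of_length_eq_zero h)
  let Q : Fin 3 → (G.induce S).Walk (f (.inl 1)) (f (.inl 0)) := fun i =>
    (A 1 i).append (A 0 i).reverse
  have hQmem : ∀ i x, x ∈ (Q i).support → ∃ k, x ∈ (A k i).support := by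
    intro i x hx
    rcases (Walk.mem_support_append_iff _ _).1 hx with h | h
    · exact ⟨1, h⟩
    · exact ⟨0, by simpa using h⟩
  have hQedge : ∀ k i e, e ∈ (A k i).edges → e ∈ (Q i).edges := by
    intro k i e he
    rw [Walk.edges_append, List.mem_append, Walk.edges_reverse, List.mem_reverse]
    match k with
    | 0 => exact .inr he
    | 1 => exact .inl he
  let φ : G.induce S ↪g G := Embedding.induce S
  have hmem : ∀ i v, v ∈ ((Q i).map φ.toHom).support → ∃ x ∈ (Q i).support, φ x = v := by
    intro i v hv
    rw [Walk.support_map] at hv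
    exact List.mem_map.1 hv
  refine ⟨_, _, fun i => (Q i).map φ.toHom, fun i => ?_, fun i => ?_, ?_, ?_⟩
  · refine Walk.IsPath.map φ.injective ((hA 1 i).append_of_forall_eq (hA 0 i).reverse ?_)
    intro x hx hx'
    rcases hAA 1 i 0 i (by simp) x hx (by simpa using hx') with h | h
    · simp at h
    · exact h.2
  · have h1 := hAlen 1 i
    have h0 := hAlen 0 i
    simp only [Walk.length_map, Q, Walk.length_append, Walk.length_reverse]
    lia
  · intro i j hij v hv hv'
    obtain ⟨x, hx, rfl⟩ := hmem i v hv
    obtain ⟨y, hy, hyx⟩ := hmem j _ hv'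
    obtain rfl := φ.injective hyx
    obtain ⟨k, hk⟩ := hQmem i y hx
    obtain ⟨l, hl⟩ := hQmem j y hy
    rcases hAA k i l j (.inr hij) y hk hl with h | h
    · obtain rfl := h.2
      match k with
      | 0 => exact .inr rfl
      | 1 => exact .inl rfl
    · exact absurd h.1 hij
  · intro i j u hu v hv huv
    obtain ⟨x, -, rfl⟩ := hmem i u hu
    obtain ⟨y, -, rfl⟩ := hmem j v hv
    obtain ⟨u, v, h, he⟩ := hedge x y (φ.map_adj_iff.1 huv)
    have hk : ∃ k i, s(x, y) ∈ (A k i).edges := by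
      rcases u with k | i <;> rcases v with l | j
      · simp at h
      · exact ⟨k, j, he⟩
      · refine ⟨l, i, ?_⟩
        rw [hrev (.inl l) (.inr i) h.symm, Walk.edges_reverse, List.mem_reverse] at he
        exact he
      · simp at h
    obtain ⟨k, i, hki⟩ := hk
    refine ⟨i, ?_⟩
    rw [Walk.edges_map]
    exact List.mem_map_of_mem (f := Sym2.map φ) (hQedge k i _ hki)

/-- Removing an end of the three paths of a theta leaves an induced tree of the auxiliary graph
at that end. -/
theorem exists_isTree_of_paths {V : Type*} {G : SimpleGraph V} {a b : V} (Q : Fin 3 → G.Walk a b)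
    (hQ : ∀ i, (Q i).IsPath) (hlen : ∀ i, 2 ≤ (Q i).length)
    (hdisj : ∀ i j, i ≠ j → ∀ x ∈ (Q i).support, x ∈ (Q j).support → x = a ∨ x = b)
    (hedge : ∀ i j, ∀ x ∈ (Q i).support, ∀ y ∈ (Q j).support, G.Adj x y →
      ∃ k, s(x, y) ∈ (Q k).edges) :
    ∃ c : Fin 3 → V, c.Injective ∧ (∀ i, G.Adj b (c i)) ∧ (∀ i j, ¬ G.Adj (c i) (c j)) ∧
      ∃ T : Set (thetaAuxVerts G b (c 0) (c 1) (c 2)), (∀ i, c i ∈ Subtype.val '' T) ∧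
        ((thetaAux G b (c 0) (c 1) (c 2)).induce T).IsTree := by
  classical
  have hend : ∀ i n, n < (Q i).length → (Q i).getVert n ≠ b := fun i n hn h =>
    hn.ne (((hQ i).getVert_eq_end_iff hn.le).1 h)
  have hinj : ∀ i n j m, n < (Q i).length → m < (Q j).length →
      (Q i).getVert n = (Q j).getVert m → n = m ∧ (n ≠ 0 → i = j) := by
    intro i n j m hn hm h
    by_cases hij : i = j
    · subst hij
      exact ⟨(hQ i).getVert_injOn hn.le hm.le h, fun _ => rfl⟩
    · rcases hdisj i j hij _ ((Q i).getVert_mem_support n)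
        (h ▸ (Q j).getVert_mem_support m) with h' | h'
      · have h0 := ((hQ i).getVert_eq_start_iff hn.le).1 h'
        have h1 := ((hQ j).getVert_eq_start_iff hm.le).1 (h ▸ h')
        exact ⟨h0.trans h1.symm, fun h => absurd h0 h⟩
      · exact absurd h' (hend i n hn)
  let S : Set V := {x | x ≠ b ∧ ∃ i, x ∈ (Q i).support}
  have hSget : ∀ i n, n < (Q i).length → (Q i).getVert n ∈ S := fun i n hn =>
    ⟨hend i n hn, i, (Q i).getVert_mem_support n⟩
  have hSex : ∀ x ∈ S, ∃ i n, n < (Q i).length ∧ (Q i).getVert n = x := by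
    rintro x ⟨hxb, i, hi⟩
    obtain ⟨n, rfl, hn⟩ := Walk.mem_support_iff_exists_getVert.1 hi
    refine ⟨i, n, hn.lt_of_ne ?_, rfl⟩
    rintro rfl
    exact hxb (Q i).getVert_length
  obtain ⟨d, hd⟩ : ∃ d : V → ℕ, ∀ i n, n < (Q i).length → d ((Q i).getVert n) = n := by
    have : ∀ x, ∃ m, ∀ i n, n < (Q i).length → (Q i).getVert n = x → n = m := by
      intro x
      by_cases hx : x ∈ S
      · obtain ⟨i, n, hn, rfl⟩ := hSex x hx
        exact ⟨n, fun j m hm h => (hinj j m i n hm hn h).1⟩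
      · exact ⟨0, fun i n hn h => absurd (h ▸ hSget i n hn) hx⟩
    choose d hd using this
    exact ⟨d, fun i n hn => (hd _ i n hn rfl).symm⟩
  have hstep : ∀ x ∈ S, ∀ y ∈ S, G.Adj x y → ∃ k n, n + 1 < (Q k).length ∧
      ((x = (Q k).getVert n ∧ y = (Q k).getVert (n + 1)) ∨
        (y = (Q k).getVert n ∧ x = (Q k).getVert (n + 1))) := by
    rintro x ⟨hxb, i, hi⟩ y ⟨hyb, j, hj⟩ hxy
    obtain ⟨k, hk⟩ := hedge i j x hi y hj hxy
    obtain ⟨n, hn, he⟩ := (Q k).mk_mem_edges_iff_exists.1 hk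
    have hn' : n + 1 ≠ (Q k).length := by
      intro h
      rw [h, Walk.getVert_length] at he
      grind
    exact ⟨k, n, by lia, by grind⟩
  let c : Fin 3 → V := fun i => (Q i).getVert ((Q i).length - 1)
  have hclt : ∀ i, (Q i).length - 1 < (Q i).length := fun i => by have := hlen i; lia
  have hcS : ∀ i, c i ∈ S := fun i => hSget i _ (hclt i)
  have hcinj : ∀ i j n, n < (Q j).length → c i = (Q j).getVert n →
      i = j ∧ n = (Q i).length - 1 := fun i j n hn h =>
    have h' := hinj i _ j n (hclt i) hn h
    ⟨h'.2 (by have := hlen i; lia), h'.1.symm⟩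
  have hcstep : ∀ i, ∀ x ∈ S, G.Adj (c i) x → x = (Q i).getVert ((Q i).length - 2) := by
    intro i x hx hadj
    obtain ⟨k, n, hn, ⟨h1, h2⟩ | ⟨h1, h2⟩⟩ := hstep _ (hcS i) x hx hadj
    · obtain ⟨rfl, h⟩ := hcinj i k n (by lia) h1
      lia
    · obtain ⟨rfl, h⟩ := hcinj i k _ hn h2
      rw [h1]
      congr 1
      lia
  have hbstep : ∀ x ∈ S, G.Adj b x → ∃ i, x = c i := by
    rintro x ⟨hxb, i, hi⟩ hbx
    obtain ⟨k, hk⟩ := hedge i i b (Q i).end_mem_support x hi hbx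
    obtain ⟨n, hn, he⟩ := (Q k).mk_mem_edges_iff_exists.1 hk
    have h1 := hend k n hn
    have h2 : x = (Q k).getVert n ∧ b = (Q k).getVert (n + 1) := by grind
    have h3 := ((hQ k).getVert_eq_end_iff (by lia)).1 h2.2.symm
    exact ⟨k, by rw [h2.1]; congr 1; lia⟩
  have hSaux : ∀ x ∈ S, x ∈ thetaAuxVerts G b (c 0) (c 1) (c 2) := by
    rintro x hx ⟨hx1 | hx1, hx2⟩
    · exact hx.1 hx1
    · obtain ⟨i, rfl⟩ := hbstep x hx hx1
      match i with
      | 0 => simp at hx2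
      | 1 => simp at hx2
      | 2 => simp at hx2
  let T : Set (thetaAuxVerts G b (c 0) (c 1) (c 2)) := {x | x.1 ∈ S}
  have hGadj : ∀ x y : T, ((thetaAux G b (c 0) (c 1) (c 2)).induce T).Adj x y ↔
      G.Adj x.1.1 y.1.1 := by
    intro x y
    refine ⟨fun ⟨hne, h⟩ => h.resolve_right ?_,
      fun h => ⟨fun h' => h.ne (congrArg Subtype.val h'), .inl h⟩⟩
    rintro ⟨v, hv, hx, hy⟩
    have hvc : ∃ i, v = c i := by
      rcases hv with h | h | h
      · exact ⟨0, h⟩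
      · exact ⟨1, h⟩
      · exact ⟨2, h⟩
    obtain ⟨i, rfl⟩ := hvc
    exact hne (Subtype.ext ((hcstep i _ x.2 hx).trans (hcstep i _ y.2 hy).symm))
  have hne0 : ∀ i, 0 < (Q i).length := fun i => by have := hlen i; lia
  have haS : a ∈ S := by simpa using hSget 0 0 (hne0 0)
  refine ⟨c, fun i j h => (hcinj i j _ (hclt j) h).1, fun i => ?_, fun i j h => ?_, T,
    fun i => ⟨⟨c i, hSaux _ (hcS i)⟩, hcS i, rfl⟩,
    isTree_of_rank ⟨⟨a, hSaux a haS⟩, haS⟩ (fun x => d x.1.1) ?_ ?_ ?_⟩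
  · have := (Q i).adj_getVert_succ (hclt i)
    rw [Nat.sub_add_cancel (hne0 i), Walk.getVert_length] at this
    exact this.symm
  · have h1 := hcstep i _ (hcS j) h
    obtain ⟨rfl, -⟩ := hcinj j i _ (by have := hlen i; lia) h1
    exact G.irrefl h
  · intro x y hxy
    obtain ⟨k, n, hn, ⟨h1, h2⟩ | ⟨h1, h2⟩⟩ := hstep _ x.2 _ y.2 ((hGadj x y).1 hxy)
    all_goals
      rw [h1, h2, hd k _ hn, hd k n (by lia)]
      simp
  · have hlow : ∀ x y : T, G.Adj x.1.1 y.1.1 → d y.1.1 < d x.1.1 → ∃ k n, n + 1 < (Q k).length ∧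
        y.1.1 = (Q k).getVert n ∧ x.1.1 = (Q k).getVert (n + 1) := by
      intro x y hxy hlt
      obtain ⟨k, n, hn, ⟨h1, h2⟩ | ⟨h1, h2⟩⟩ := hstep _ x.2 _ y.2 hxy
      · rw [h1, h2, hd k _ hn, hd k n (by lia)] at hlt
        lia
      · exact ⟨k, n, hn, h1, h2⟩
    intro x y z hxy hxz hy hz
    obtain ⟨k, n, hn, h1, h2⟩ := hlow x y ((hGadj _ _).1 hxy) hy
    obtain ⟨l, m, hm, h3, h4⟩ := hlow x z ((hGadj _ _).1 hxz) hz
    obtain ⟨hnm, hkl⟩ := hinj k _ l _ hn hm (h2.symm.trans h4)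
    obtain rfl := hkl (by simp)
    obtain rfl : n = m := by lia
    exact Subtype.ext (Subtype.ext (h1.trans h3.symm))
  · intro x hxa
    obtain ⟨i, n, hn, hx⟩ := hSex _ x.2
    have hn0 : n ≠ 0 := by
      rintro rfl
      exact hxa (Subtype.ext (Subtype.ext (by rw [← hx, Walk.getVert_zero])))
    have hn1 : n - 1 < (Q i).length := by lia
    refine ⟨⟨⟨(Q i).getVert (n - 1), hSaux _ (hSget i _ hn1)⟩, hSget i _ hn1⟩, ?_, ?_⟩
    · rw [hGadj]
      have := (Q i).adj_getVert_succ hn1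
      rw [Nat.sub_add_cancel (by lia), hx] at this
      exact this.symm
    · change d ((Q i).getVert (n - 1)) < d x.1.1
      rw [← hx, hd i _ hn, hd i _ hn1]
      lia

end Detect

theorem containsTheta_iff_three_in_a_tree {V : Type*} [Finite V] (G : SimpleGraph V) :
    Detect.ContainsTheta G ↔
      ∃ b b1 b2 b3 : V,
        b ≠ b1 ∧ b ≠ b2 ∧ b ≠ b3 ∧ b1 ≠ b2 ∧ b2 ≠ b3 ∧ b1 ≠ b3 ∧
        G.Adj b b1 ∧ G.Adj b b2 ∧ G.Adj b b3 ∧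
        ¬ G.Adj b1 b2 ∧ ¬ G.Adj b2 b3 ∧ ¬ G.Adj b1 b3 ∧
        ∃ T : Set (Detect.thetaAuxVerts G b b1 b2 b3),
          b1 ∈ Subtype.val '' T ∧ b2 ∈ Subtype.val '' T ∧ b3 ∈ Subtype.val '' T ∧
          ((Detect.thetaAux G b b1 b2 b3).induce T).IsTree := by
  constructor
  · intro h
    obtain ⟨a, b, Q, hQ, hlen, hdisj, hedge⟩ := h.exists_paths
    obtain ⟨c, hc, hbc, hcc, T, hcT, hT⟩ :=
      Detect.exists_isTree_of_paths Q hQ hlen hdisj hedge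
    exact ⟨b, c 0, c 1, c 2, (hbc 0).ne, (hbc 1).ne, (hbc 2).ne, hc.ne (by simp),
      hc.ne (by simp), hc.ne (by simp), hbc 0, hbc 1, hbc 2, hcc 0 1, hcc 1 2, hcc 0 2, T,
      hcT 0, hcT 1, hcT 2, hT⟩
  · rintro ⟨b, b1, b2, b3, -, -, -, h12, h23, h13, hb1, hb2, hb3, -, -, -, T, hT1, hT2, hT3, hT⟩
    exact Detect.containsTheta_of_isTree h12 h23 h13 hb1 hb2 hb3 T hT1 hT2 hT3 hT
end

section
/- Let $G$ be a finite simple undirected graph; $G[S]$ denotes the subgraph induced by a vertex set $S$, $N(v)$ the set of neighbors of $v$ in $G$, and $N[v]=N(v)\cup\{v\}$. A \emph{beetle} of $G$ is an induced subgraph of $G$ that is the union of a cycle $b_1b_2b_3b_4b_1$ of $G$ having exactly one chord in $G$, namely $b_2b_4$, this chord, and a tree $T$ that is a (not necessarily induced) subgraph of $G-b_4$ whose leaves are exactly the three vertices $b_1,b_2,b_3$. Then $G$ contains a beetle if and only if there exist distinct vertices $b_1,b_2,b_3,b_4$ of $G$ such that $G[\{b_1,b_2,b_3,b_4\}]$ is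 a cycle $b_1b_2b_3b_4b_1$ with exactly one chord $b_2b_4$, and the graph $G(b_1,b_2,b_3,b_4)$ contains an induced subgraph that is a tree containing all of $b_1,b_2,b_3$. Here $G(b_1,b_2,b_3,b_4)$ is obtained from $G$ by (1) deleting all vertices of $N[b_4]\setminus\{b_1,b_2,b_3\}$ and the two edges $b_1b_2$ and $b_2b_3$, and then (2) for each $i\in\{1,2,3\}$, adding edges so that the remaining vertices of $N(b_i)\setminus\{b_1,b_2,b_3\}$ form a clique. -/
namespace Detect

/-- The four distinct vertices `b1, b2, b3, b4` induce in `G` a cycle `b1 b2 b3 b4 b1`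
with exactly one chord `b2 b4`. -/
def IsDiamond {V : Type*} (G : SimpleGraph V) (b1 b2 b3 b4 : V) : Prop :=
  (b1 ≠ b2 ∧ b1 ≠ b3 ∧ b1 ≠ b4 ∧ b2 ≠ b3 ∧ b2 ≠ b4 ∧ b3 ≠ b4) ∧
  (G.Adj b1 b2 ∧ G.Adj b2 b3 ∧ G.Adj b3 b4 ∧ G.Adj b4 b1) ∧
  G.Adj b2 b4 ∧ ¬ G.Adj b1 b3

/-- The set of leaves of a subgraph `T`: its vertices of degree one in `T`. -/
def leafSet {V : Type*} {G : SimpleGraph V} (T : G.Subgraph) : Set V :=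
  {v | v ∈ T.verts ∧ ∃! w, T.Adj v w}

/-- The subgraph `H` of `G` is a beetle: it is an induced subgraph of `G`, and it is the union of
a diamond of `G` (a cycle `b1 b2 b3 b4 b1` with the one chord `b2 b4`) and a tree `T` of `G - b4`
whose leaves are exactly `b1, b2, b3`. The tree `T` is a subgraph of `G`, not necessarily an
induced one: the edges `b1 b2` and `b2 b3` of `G` do not belong to it. -/
def IsBeetle {V : Type*} {G : SimpleGraph V} (H : G.Subgraph) : Prop :=
  H.IsInduced ∧ ∃ (b1 b2 b3 b4 : V) (T : G.Subgraph),
    IsDiamond G b1 b2 b3 b4 ∧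
    b4 ∉ T.verts ∧ T.coe.IsTree ∧ leafSet T = {b1, b2, b3} ∧
    H = (⊤ : G.Subgraph).induce {b1, b2, b3, b4} ⊔ T

/-- `G` contains a beetle. -/
def ContainsBeetle {V : Type*} (G : SimpleGraph V) : Prop :=
  ∃ H : G.Subgraph, IsBeetle H

/-- The vertices that remain when `N[b4] ∖ {b1, b2, b3}` is deleted. -/
def beetleVerts {V : Type*} (G : SimpleGraph V) (b1 b2 b3 b4 : V) : Set V :=
  {v | v ∉ insert b4 (G.neighborSet b4) \ {b1, b2, b3}}

/-- The auxiliary graph `G(b1, b2, b3, b4)`: from `G`, delete the vertices of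
`N[b4] ∖ {b1, b2, b3}`, delete the edges `b1 b2` and `b2 b3`, and add edges so that, for each `b`
among `b1, b2, b3`, the remaining vertices of `N(b) ∖ {b1, b2, b3}` form a clique. Here `N` refers
to the graph `G`. -/
def beetleAux {V : Type*} (G : SimpleGraph V) (b1 b2 b3 b4 : V) :
    SimpleGraph (beetleVerts G b1 b2 b3 b4) :=
  (G.deleteEdges {s(b1, b2), s(b2, b3)} ⊔
    SimpleGraph.fromRel (fun x y => ∃ b ∈ ({b1, b2, b3} : Set V),
      x ∈ G.neighborSet b \ {b1, b2, b3} ∧ y ∈ G.neighborSet b \ {b1, b2, b3})).induce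
    (beetleVerts G b1 b2 b3 b4)

end Detect

namespace SimpleGraph

variable {V : Type*} {G : SimpleGraph V}

/-- Inducing twice is the same as inducing once on the image. -/
noncomputable def induceInduceIso (G : SimpleGraph V) (s : Set V) (t : Set s) :
    (G.induce s).induce t ≃g G.induce (Subtype.val '' t) where
  toEquiv := Equiv.Set.image Subtype.val t Subtype.val_injective
  map_rel_iff' := Iff.rfl

lemma IsAcyclic.not_adj_of_adj_of_adj (h : G.IsAcyclic) {a b c : V} (hab : G.Adj a b)
    (hac : G.Adj a c) : ¬ G.Adj b c := by
  classical
  intro hbc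
  exact h.cliqueFree le_rfl {a, b, c} (is3Clique_triple_iff.2 ⟨hab, hac, hbc⟩)

/-- Deleting a vertex with at most one neighbor from an induced tree with at least one other vertex
leaves an induced tree. -/
lemma IsTree.induce_diff_singleton {s : Set V} (hs : (G.induce s).IsTree) {u v : V} (hu : u ∈ s)
    (huv : u ≠ v) (hv : {w | w ∈ s ∧ G.Adj v w}.Subsingleton) : (G.induce (s \ {v})).IsTree := by
  have hset : Subtype.val '' {x : s | x.1 ≠ v} = s \ {v} := by
    ext x; simp [and_comm]
  rw [← hset, ← (induceInduceIso G s _).isTree_iff]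
  refine ⟨(connected_iff _).2 ⟨hs.connected.preconnected.induce_of_degree_eq_one ?_,
    ⟨⟨⟨u, hu⟩, huv⟩⟩⟩, hs.isAcyclic.induce _⟩
  rintro ⟨x, hx⟩ hxv ⟨y, hy⟩ hxy ⟨z, hz⟩ hxz
  obtain rfl : x = v := by simpa using hxv
  exact Subtype.ext (hv ⟨hy, hxy⟩ ⟨hz, hxz⟩)

/-- Every induced tree containing a nonempty vertex set `B` contains an induced tree
containing `B` all of whose leaves are in `B`. -/
lemma exists_induce_isTree_leaves_subset [Finite V] {s B : Set V} (hs : (G.induce s).IsTree)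
    (hB : B.Nonempty) (hBs : B ⊆ s) :
    ∃ t ⊆ s, B ⊆ t ∧ (G.induce t).IsTree ∧ ∀ v ∈ t, v ∉ B → ¬ ∃! w, w ∈ t ∧ G.Adj v w := by
  obtain ⟨t, hts, ht⟩ := exists_minimal_le_of_wellFoundedLT
    (fun t : Set V ↦ B ⊆ t ∧ (G.induce t).IsTree) s ⟨hBs, hs⟩
  refine ⟨t, hts, ht.prop.1, ht.prop.2, fun v hvt hvB hv ↦ ?_⟩
  obtain ⟨u, hu⟩ := hB
  have huv : u ≠ v := fun h ↦ hvB (h ▸ hu)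
  have hle : t ⊆ t \ {v} := ht.le_of_le
    ⟨Set.subset_sdiff_singleton ht.prop.1 hvB,
      ht.prop.2.induce_diff_singleton (ht.prop.1 hu) huv fun _ h _ h' ↦ hv.unique h h'⟩
    Set.sdiff_subset
  exact (hle hvt).2 rfl

end SimpleGraph

namespace Detect

open SimpleGraph

variable {V : Type*} {G : SimpleGraph V} {b1 b2 b3 b4 : V}

/-- The graph on the whole vertex type whose restriction to `beetleVerts` is `beetleAux`. -/
def ambientAux (G : SimpleGraph V) (b1 b2 b3 : V) : SimpleGraph V :=
  G.deleteEdges {s(b1, b2), s(b2, b3)} ⊔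
    SimpleGraph.fromRel (fun x y => ∃ b ∈ ({b1, b2, b3} : Set V),
      x ∈ G.neighborSet b \ {b1, b2, b3} ∧ y ∈ G.neighborSet b \ {b1, b2, b3})

lemma beetleAux_eq_induce :
    beetleAux G b1 b2 b3 b4 = (ambientAux G b1 b2 b3).induce (beetleVerts G b1 b2 b3 b4) := rfl

lemma ambientAux_adj {x y : V} : (ambientAux G b1 b2 b3).Adj x y ↔
    (G.Adj x y ∧ s(x, y) ∉ ({s(b1, b2), s(b2, b3)} : Set (Sym2 V))) ∨
    (x ≠ y ∧ ∃ b ∈ ({b1, b2, b3} : Set V), (G.Adj b x ∧ x ∉ ({b1, b2, b3} : Set V)) ∧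
      G.Adj b y ∧ y ∉ ({b1, b2, b3} : Set V)) := by
  simp only [ambientAux, sup_adj, deleteEdges_adj, fromRel_adj, Set.mem_sdiff, mem_neighborSet]
  refine or_congr Iff.rfl (and_congr Iff.rfl ⟨?_, Or.inl⟩)
  rintro (h | ⟨b, hb, h, h'⟩)
  exacts [h, ⟨b, hb, h', h⟩]

/-- If inside `S` every `b` among `b1, b2, b3` has at most one neighbor other than `b1, b2, b3`,
then no edge of the auxiliary graph with both ends in `S` is an added one. -/
lemma ambientAux_adj_of_subsingleton {S : Set V}
    (hS : ∀ b ∈ ({b1, b2, b3} : Set V),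
      {w | w ∈ S ∧ G.Adj b w ∧ w ∉ ({b1, b2, b3} : Set V)}.Subsingleton)
    {x y : V} (hx : x ∈ S) (hy : y ∈ S) : (ambientAux G b1 b2 b3).Adj x y ↔
    G.Adj x y ∧ s(x, y) ∉ ({s(b1, b2), s(b2, b3)} : Set (Sym2 V)) := by
  rw [ambientAux_adj]
  refine ⟨?_, Or.inl⟩
  rintro (h | ⟨hne, b, hb, hbx, hby⟩)
  exacts [h, absurd (hS b hb ⟨hx, hbx⟩ ⟨hy, hby⟩) hne]

lemma mem_beetleVerts {v : V} : v ∈ beetleVerts G b1 b2 b3 b4 ↔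
    (v = b4 ∨ G.Adj b4 v → v ∈ ({b1, b2, b3} : Set V)) := by
  simp only [beetleVerts, Set.mem_ofPred_eq, Set.mem_sdiff, Set.mem_insert_iff, mem_neighborSet]
  tauto

/-- Among `b1, b2, b3`, a diamond has only the edges `b1 b2` and `b2 b3`. -/
lemma IsDiamond.mem_of_adj (h : IsDiamond G b1 b2 b3 b4) {x y : V}
    (hx : x ∈ ({b1, b2, b3} : Set V)) (hy : y ∈ ({b1, b2, b3} : Set V)) (hxy : G.Adj x y) :
    s(x, y) ∈ ({s(b1, b2), s(b2, b3)} : Set (Sym2 V)) := by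
  have h13 := h.2.2.2
  have h31 : ¬ G.Adj b3 b1 := fun h' ↦ h13 h'.symm
  simp only [Set.mem_insert_iff, Set.mem_singleton_iff] at hx hy ⊢
  rcases hx with rfl | rfl | rfl <;> rcases hy with rfl | rfl | rfl <;> simp_all

lemma mem_of_mem_deleted {x y : V}
    (h : s(x, y) ∈ ({s(b1, b2), s(b2, b3)} : Set (Sym2 V))) :
    x ∈ ({b1, b2, b3} : Set V) ∧ y ∈ ({b1, b2, b3} : Set V) := by
  simp only [Set.mem_insert_iff, Set.mem_singleton_iff, Sym2.eq_iff] at h ⊢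
  tauto

/-- Two leaves of a tree with a further vertex are not adjacent in it. -/
lemma not_adj_of_mem_leafSet {T : G.Subgraph} (hT : T.coe.Connected) {x y z : V}
    (hx : x ∈ leafSet T) (hy : y ∈ leafSet T) (hz : z ∈ T.verts) (hzx : z ≠ x) (hzy : z ≠ y) :
    ¬ T.Adj x y := by
  intro hxy
  have key : ∀ {u v : T.verts}, T.coe.Reachable u v → (u.1 = x ∨ u.1 = y) →
      (v.1 = x ∨ v.1 = y) := by
    rintro u v ⟨p⟩
    induction p with
    | nil => exact id
    | @cons u w v huw p ih =>
      refine fun hu ↦ ih ?_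
      have huw' : T.Adj u.1 w.1 := huw
      rcases hu with hu | hu <;> rw [hu] at huw'
      · exact .inr (hx.2.unique huw' hxy)
      · exact .inl (hy.2.unique huw' hxy.symm)
  rcases key (hT.preconnected ⟨x, hx.1⟩ ⟨z, hz⟩) (.inl rfl) with h | h
  exacts [hzx h, hzy h]

lemma exists_induce_isTree_of_isBeetle {H : G.Subgraph} (hH : IsBeetle H) :
    ∃ b1 b2 b3 b4 : V, IsDiamond G b1 b2 b3 b4 ∧ ∃ S ⊆ beetleVerts G b1 b2 b3 b4,
      {b1, b2, b3} ⊆ S ∧ ((ambientAux G b1 b2 b3).induce S).IsTree := by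
  obtain ⟨hind, b1, b2, b3, b4, T, hd, hb4, hT, hleaf, rfl⟩ := hH
  have hBT : ({b1, b2, b3} : Set V) ⊆ T.verts := fun x hx ↦ (hleaf ▸ hx : x ∈ leafSet T).1
  have hleaf1 : b1 ∈ leafSet T := by simp [hleaf]
  have hleaf2 : b2 ∈ leafSet T := by simp [hleaf]
  have hleaf3 : b3 ∈ leafSet T := by simp [hleaf]
  have h12 : ¬ T.Adj b1 b2 := not_adj_of_mem_leafSet hT.connected hleaf1 hleaf2 hleaf3.1
    hd.1.2.1.symm hd.1.2.2.2.1.symm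
  have h23 : ¬ T.Adj b2 b3 := not_adj_of_mem_leafSet hT.connected hleaf2 hleaf3 hleaf1.1
    hd.1.1 hd.1.2.1
  have hverts : ∀ x, x = b4 ∨ x ∈ T.verts →
      x ∈ ((⊤ : G.Subgraph).induce {b1, b2, b3, b4} ⊔ T).verts := by
    rintro x (rfl | hx)
    exacts [.inl (by simp), .inr hx]
  have hsplit : ∀ {x y}, (x = b4 ∨ x ∈ T.verts) → (y = b4 ∨ y ∈ T.verts) → G.Adj x y →
      (x ∈ ({b1, b2, b3, b4} : Set V) ∧ y ∈ ({b1, b2, b3, b4} : Set V)) ∨ T.Adj x y := by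
    intro x y hx hy hxy
    rcases hind (hverts x hx) (hverts y hy) hxy with h | h
    exacts [.inl ⟨h.1, h.2.1⟩, .inr h]
  have hmem : ∀ {x}, x ∈ ({b1, b2, b3, b4} : Set V) → x ∈ T.verts →
      x ∈ ({b1, b2, b3} : Set V) := by
    rintro x (h | h | h | h) hx
    · exact .inl h
    · exact .inr (.inl h)
    · exact .inr (.inr h)
    · exact absurd ((h : x = b4) ▸ hx) hb4
  have hTadj : ∀ {x y}, x ∈ T.verts → y ∈ T.verts →
      (G.Adj x y ∧ s(x, y) ∉ ({s(b1, b2), s(b2, b3)} : Set (Sym2 V)) ↔ T.Adj x y) := by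
    intro x y hx hy
    constructor
    · rintro ⟨hxy, hne⟩
      rcases hsplit (.inr hx) (.inr hy) hxy with h | h
      · exact absurd (hd.mem_of_adj (hmem h.1 hx) (hmem h.2 hy) hxy) hne
      · exact h
    · refine fun h ↦ ⟨h.adj_sub, ?_⟩
      rintro (h' | h')
      · rcases Sym2.eq_iff.1 h' with ⟨rfl, rfl⟩ | ⟨rfl, rfl⟩
        exacts [h12 h, h12 h.symm]
      · rcases Sym2.eq_iff.1 h' with ⟨rfl, rfl⟩ | ⟨rfl, rfl⟩
        exacts [h23 h, h23 h.symm]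
  have hS : ∀ b ∈ ({b1, b2, b3} : Set V),
      {w | w ∈ T.verts ∧ G.Adj b w ∧ w ∉ ({b1, b2, b3} : Set V)}.Subsingleton := by
    rintro b hb x ⟨hx, hbx, hxB⟩ y ⟨hy, hby, hyB⟩
    have hbl : b ∈ leafSet T := hleaf ▸ hb
    exact hbl.2.unique
      ((hTadj (hBT hb) hx).1 ⟨hbx, fun h ↦ hxB (mem_of_mem_deleted h).2⟩)
      ((hTadj (hBT hb) hy).1 ⟨hby, fun h ↦ hyB (mem_of_mem_deleted h).2⟩)
  refine ⟨b1, b2, b3, b4, hd, T.verts, fun x hx ↦ mem_beetleVerts.2 ?_, hBT, ?_⟩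
  · rintro (rfl | h)
    · exact absurd hx hb4
    · rcases hsplit (.inl rfl) (.inr hx) h with h | h
      · exact hmem h.2 hx
      · exact absurd h.fst_mem hb4
  · have : (ambientAux G b1 b2 b3).induce T.verts = T.coe := by
      ext ⟨x, hx⟩ ⟨y, hy⟩
      exact (ambientAux_adj_of_subsingleton hS hx hy).trans (hTadj hx hy)
    rwa [this]

lemma containsBeetle_of_induce_isTree [Finite V] (hd : IsDiamond G b1 b2 b3 b4) {S : Set V}
    (hSW : S ⊆ beetleVerts G b1 b2 b3 b4) (hBS : {b1, b2, b3} ⊆ S)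
    (htree : ((ambientAux G b1 b2 b3).induce S).IsTree) : ContainsBeetle G := by
  obtain ⟨t, htS, hBt, ht, hleaf⟩ :=
    exists_induce_isTree_leaves_subset htree (Set.insert_nonempty _ _) hBS
  have hB4 : b4 ∉ ({b1, b2, b3} : Set V) := by
    rintro (h | h | h)
    exacts [hd.1.2.2.1 h.symm, hd.1.2.2.2.2.1 h.symm, hd.1.2.2.2.2.2 h.symm]
  have h4t : b4 ∉ t := fun h ↦ hB4 (mem_beetleVerts.1 (hSW (htS h)) (.inl rfl))
  have hadjB : ∀ {b w}, b ∈ ({b1, b2, b3} : Set V) → G.Adj b w → w ∉ ({b1, b2, b3} : Set V) →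
      (ambientAux G b1 b2 b3).Adj b w := fun _ h hw ↦
    ambientAux_adj.2 (.inl ⟨h, fun h' ↦ hw (mem_of_mem_deleted h').2⟩)
  have hS : ∀ b ∈ ({b1, b2, b3} : Set V),
      {w | w ∈ t ∧ G.Adj b w ∧ w ∉ ({b1, b2, b3} : Set V)}.Subsingleton := by
    rintro b hb x ⟨hx, hbx, hxB⟩ y ⟨hy, hby, hyB⟩
    by_contra hne
    refine ht.isAcyclic.not_adj_of_adj_of_adj (a := ⟨b, hBt hb⟩) (b := ⟨x, hx⟩) (c := ⟨y, hy⟩)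
      (hadjB hb hbx hxB) (hadjB hb hby hyB) ?_
    exact ambientAux_adj.2 (.inr ⟨hne, b, hb, ⟨hbx, hxB⟩, hby, hyB⟩)
  have hadj : ∀ {x y}, x ∈ t → y ∈ t → ((ambientAux G b1 b2 b3).Adj x y ↔
      G.Adj x y ∧ s(x, y) ∉ ({s(b1, b2), s(b2, b3)} : Set (Sym2 V))) :=
    fun hx hy ↦ ambientAux_adj_of_subsingleton hS hx hy
  let T : G.Subgraph :=
    { verts := t
      Adj := fun x y ↦ x ∈ t ∧ y ∈ t ∧ (ambientAux G b1 b2 b3).Adj x y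
      adj_sub := fun h ↦ ((hadj h.1 h.2.1).1 h.2.2).1
      edge_vert := fun h ↦ h.1
      symm := ⟨fun _ _ h ↦ ⟨h.2.1, h.1, h.2.2.symm⟩⟩ }
  have hT : T.coe = (ambientAux G b1 b2 b3).induce t := by
    ext ⟨x, hx⟩ ⟨y, hy⟩
    exact ⟨fun h ↦ h.2.2, fun h ↦ ⟨hx, hy, h⟩⟩
  have hTleaf : leafSet T = {b1, b2, b3} := by
    ext v
    constructor
    · rintro ⟨hv, w, hw, huniq⟩
      by_contra hvB
      exact hleaf v hv hvB ⟨w, hw.2, fun y hy ↦ huniq y ⟨hv, hy⟩⟩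
    · intro hv
      have hvt := hBt hv
      have : Nontrivial t := ⟨⟨b1, hBt (by simp)⟩, ⟨b2, hBt (by simp)⟩, by simpa using hd.1.1⟩
      obtain ⟨⟨w, hw⟩, hvw⟩ := ht.connected.preconnected.exists_adj_of_nontrivial ⟨v, hvt⟩
      have hout : ∀ {w}, w ∈ t → (ambientAux G b1 b2 b3).Adj v w →
          w ∈ {w | w ∈ t ∧ G.Adj v w ∧ w ∉ ({b1, b2, b3} : Set V)} := by
        intro w hw hvw
        have h := (hadj hvt hw).1 hvw
        exact ⟨hw, h.1, fun hwB ↦ h.2 (hd.mem_of_adj hv hwB h.1)⟩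
      exact ⟨hvt, w, ⟨hvt, hw, hvw⟩, fun y hy ↦ hS v hv (hout hy.2.1 hy.2.2) (hout hw hvw)⟩
  refine ⟨_, ?_, b1, b2, b3, b4, T, hd, h4t, hT ▸ ht, hTleaf, rfl⟩
  have hB : ∀ {x}, x ∈ ({b1, b2, b3} : Set V) → x ∈ ({b1, b2, b3, b4} : Set V) := by
    rintro x (h | h | h)
    exacts [.inl h, .inr (.inl h), .inr (.inr (.inl h))]
  have hverts : ∀ {x}, x ∈ ((⊤ : G.Subgraph).induce {b1, b2, b3, b4} ⊔ T).verts →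
      x = b4 ∨ x ∈ t := by
    rintro x ((h | h | h | h) | h)
    · exact .inr (hBt (.inl h))
    · exact .inr (hBt (.inr (.inl h)))
    · exact .inr (hBt (.inr (.inr h)))
    · exact .inl h
    · exact .inr h
  have h4 : b4 ∈ ({b1, b2, b3, b4} : Set V) := by simp
  have hnbr : ∀ {x}, x ∈ t → G.Adj b4 x → x ∈ ({b1, b2, b3, b4} : Set V) := fun hx h ↦
    hB (mem_beetleVerts.1 (hSW (htS hx)) (.inr h))
  intro x hx y hy hxy
  rcases hverts hx with rfl | hxt <;> rcases hverts hy with rfl | hyt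
  · exact absurd hxy (G.loopless.irrefl _)
  · exact .inl ⟨h4, hnbr hyt hxy, hxy⟩
  · exact .inl ⟨hnbr hxt hxy.symm, h4, hxy⟩
  · by_cases h : s(x, y) ∈ ({s(b1, b2), s(b2, b3)} : Set (Sym2 V))
    · exact .inl ⟨hB (mem_of_mem_deleted h).1, hB (mem_of_mem_deleted h).2, hxy⟩
    · exact .inr ⟨hxt, hyt, (hadj hxt hyt).2 ⟨hxy, h⟩⟩

end Detect

theorem containsBeetle_iff_three_in_a_tree {V : Type*} [Finite V] (G : SimpleGraph V) :
    Detect.ContainsBeetle G ↔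
      ∃ b1 b2 b3 b4 : V, Detect.IsDiamond G b1 b2 b3 b4 ∧
        ∃ T : Set (Detect.beetleVerts G b1 b2 b3 b4),
          {b1, b2, b3} ⊆ Subtype.val '' T ∧
          ((Detect.beetleAux G b1 b2 b3 b4).induce T).IsTree := by
  constructor
  · rintro ⟨H, hH⟩
    obtain ⟨b1, b2, b3, b4, hd, S, hSW, hBS, hS⟩ := Detect.exists_induce_isTree_of_isBeetle hH
    have himage : Subtype.val '' {x : Detect.beetleVerts G b1 b2 b3 b4 | x.1 ∈ S} = S := by
      ext x
      simpa using fun hx ↦ hSW hx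
    refine ⟨b1, b2, b3, b4, hd, {x | x.1 ∈ S}, himage.symm ▸ hBS, ?_⟩
    rw [Detect.beetleAux_eq_induce, (SimpleGraph.induceInduceIso _ _ _).isTree_iff, himage]
    exact hS
  · rintro ⟨b1, b2, b3, b4, hd, T, hBT, hT⟩
    rw [Detect.beetleAux_eq_induce, (SimpleGraph.induceInduceIso _ _ _).isTree_iff] at hT
    exact Detect.containsBeetle_of_induce_isTree hd (Subtype.coe_image_subset _ _) hBT hT
end
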